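/- arXiv:2303.09504 — 3 statements merged into one kernel-verified Lean document; each statement's English description precedes it below -/
import Mathlib

section
/- Let $A_\Gamma$ be an Artin group with standard generating set $X$, let $T \subseteq X$ be a nonempty subset, let $A_T$ be the Artin group of the full labelled subgraph of $\Gamma$ spanned by $T$, with Artin monoid $M_T \subseteq A_T$, and let $\iota : A_T \to A_\Gamma$ be the homomorphism sending each generator of $T$ to itself. Then $\iota$ is an isometric embedding of monoid Cayley graphs: for every $g \in A_T$, $d_{M}(e, \iota(g)) = d_{M_T}(e, g)$, where $d_M$ is the monoid word metric on $A_\Gamma$ and $d_{M_T}$ is the monoid word metric on $A_T$. -/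
/-- The alternating product `x y x y ⋯` of length `n` in the free group, starting with `x`. -/
def altProd {X : Type*} : ℕ → X → X → FreeGroup X
  | 0, _, _ => 1
  | n + 1, x, y => FreeGroup.of x * altProd n y x

/-- The Artin relations associated to a labelling `m : X → X → ℕ∞` (label `⊤` = no relation):
for each pair `x ≠ y` with finite label `k`, the relator `(xyx⋯)(yxy⋯)⁻¹` (both of length `k`). -/
def artinRels {X : Type*} (m : X → X → ℕ∞) : Set (FreeGroup X) :=
  { r | ∃ (x y : X) (k : ℕ), x ≠ y ∧ m x y = (k : ℕ∞) ∧
      r = altProd k x y * (altProd k y x)⁻¹ }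

/-- The Artin group of the labelled graph encoded by `m`. -/
abbrev ArtinGroup {X : Type*} (m : X → X → ℕ∞) : Type _ := PresentedGroup (artinRels m)

/-- The standard generators of the Artin group. -/
def artinGen {X : Type*} (m : X → X → ℕ∞) (x : X) : ArtinGroup m := PresentedGroup.of x

/-- The Artin monoid: the submonoid of the Artin group generated by the standard generators. -/
def artinMonoid {X : Type*} (m : X → X → ℕ∞) : Submonoid (ArtinGroup m) :=
  Submonoid.closure (Set.range (artinGen m))

/-- The monoid word metric on a group `G` relative to a submonoid `M`: `monoidDist M g h` is the
least `n` such that `g⁻¹ * h` is a product of `n` elements each lying in `M` or `M⁻¹`. -/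
noncomputable def monoidDist {G : Type*} [Group G] (M : Submonoid G) (g h : G) : ℕ :=
  sInf { n : ℕ | ∃ l : List G, l.length = n ∧ (∀ a ∈ l, a ∈ M ∨ a⁻¹ ∈ M) ∧ g⁻¹ * h = l.prod }

/-- A word over `X`: a list of letters `x^ε`, where `ε = true` denotes the positive letter `x`
and `ε = false` the negative letter `x⁻¹`. -/
abbrev Word (X : Type*) := List (X × Bool)

/-- The element of `G` represented by a word over `X`, given `f : X → G`. -/
def evalWord {X G : Type*} [Group G] (f : X → G) (w : Word X) : G :=
  (w.map (fun p => if p.2 then f p.1 else (f p.1)⁻¹)).prod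

/-- A word is positive if all its letters are positive. -/
def IsPosWord {X : Type*} (w : Word X) : Prop := ∀ p ∈ w, p.2 = true

/-- A word is negative if all its letters are negative. -/
def IsNegWord {X : Type*} (w : Word X) : Prop := ∀ p ∈ w, p.2 = false

/-- A word is geodesic if no strictly shorter word represents the same element of `G`. -/
def IsGeodesic {X G : Type*} [Group G] (f : X → G) (w : Word X) : Prop :=
  ∀ v : Word X, evalWord f v = evalWord f w → w.length ≤ v.length

/-- `(u, x)` is a blocking pair if for every word `w` such that `w ++ u` is geodesic,
the word `w ++ u ++ [x]` is also geodesic. -/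
def BlockingPair {X G : Type*} [Group G] (f : X → G) (u : Word X) (x : X × Bool) : Prop :=
  ∀ w : Word X, IsGeodesic f (w ++ u) → IsGeodesic f (w ++ u ++ [x])

/-- An alternating blocking sequence `(α n)` (indexed from `n = 1`; the value `α 0` is ignored):
each `α n` is nonempty, positive for odd `n` and negative for even `n`, and every letter `x`
of `α n` is immediately preceded, within `α (n-1) ++ α n` (with `α 0` read as the empty word),
by a subword `u` such that `(u, x)` is a blocking pair. -/
def IsAltBlockingSeq {X G : Type*} [Group G] (f : X → G) (α : ℕ → Word X) : Prop :=
  (∀ n, 1 ≤ n → α n ≠ []) ∧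
  (∀ n, 1 ≤ n → Odd n → IsPosWord (α n)) ∧
  (∀ n, 1 ≤ n → Even n → IsNegWord (α n)) ∧
  (∀ n, 1 ≤ n → ∀ p x s, α n = p ++ x :: s →
    ∃ u : Word X, u <:+ ((if n = 1 then ([] : Word X) else α (n - 1)) ++ p) ∧
      BlockingPair f u x)

/-- `u` is the longest positive (`ε = true`) resp. negative (`ε = false`) proper suffix of `w`. -/
def IsLongestSignedProperSuffix {X : Type*} (ε : Bool) (w u : Word X) : Prop :=
  u <:+ w ∧ u ≠ w ∧ (∀ p ∈ u, p.2 = ε) ∧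
    ∀ v : Word X, v <:+ w → v ≠ w → (∀ p ∈ v, p.2 = ε) → v.length ≤ u.length

/-- Preserved positive (`ε = true`) resp. negative (`ε = false`) suffixes: whenever `w` is a
geodesic word ending in a letter of sign `ε`, `u` is the longest proper suffix of `w` of sign `ε`,
and `a` is a generator, the element represented by `a^ε · w` admits a geodesic representative
having `u` as a suffix. -/
def PreservedSignSuffixes {X G : Type*} [Group G] (ε : Bool) (f : X → G) : Prop :=
  ∀ (w : Word X) (y : X), IsGeodesic f w → w.getLast? = some (y, ε) →
    ∀ u : Word X, IsLongestSignedProperSuffix ε w u →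
    ∀ a : X, ∃ w' : Word X, IsGeodesic f w' ∧
      evalWord f w' = evalWord f ((a, ε) :: w) ∧ u <:+ w'

/-- Preserved signed suffixes: both preserved positive and preserved negative suffixes. -/
def PreservedSignedSuffixes {X G : Type*} [Group G] (f : X → G) : Prop :=
  PreservedSignSuffixes true f ∧ PreservedSignSuffixes false f

noncomputable section

open Real

namespace Coxeter

/-- The coefficients `sin (n θ) / sin θ`, as polynomials in `κ = cos θ`, which occur in the roots
of a dihedral group. -/
def dihedralCoeff (κ : ℝ) : ℕ → ℝ
  | 0 => 0
  | 1 => 1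
  | n + 2 => 2 * κ * dihedralCoeff κ (n + 1) - dihedralCoeff κ n

theorem dihedralCoeff_cos_mul_sin (θ : ℝ) : ∀ n : ℕ,
    dihedralCoeff (cos θ) n * sin θ = sin (n * θ)
  | 0 => by simp [dihedralCoeff]
  | 1 => by simp [dihedralCoeff]
  | n + 2 => by
    have h1 := dihedralCoeff_cos_mul_sin θ (n + 1)
    have h2 := dihedralCoeff_cos_mul_sin θ n
    have e1 : ((n + 2 : ℕ) : ℝ) * θ = ((n + 1 : ℕ) : ℝ) * θ + θ := by push_cast; ring
    have e2 : (n : ℝ) * θ = ((n + 1 : ℕ) : ℝ) * θ - θ := by push_cast; ring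
    rw [e2, sin_sub] at h2
    rw [e1, sin_add, dihedralCoeff, sub_mul, h2, mul_assoc, h1]
    ring

theorem dihedralCoeff_one : ∀ n : ℕ, dihedralCoeff 1 n = n
  | 0 => by simp [dihedralCoeff]
  | 1 => by simp [dihedralCoeff]
  | n + 2 => by
    rw [dihedralCoeff, dihedralCoeff_one (n + 1), dihedralCoeff_one n]; push_cast; ring

theorem sin_pi_div_pos {k : ℕ} (hk : 2 ≤ k) : 0 < sin (π / k) := by
  have hk' : (2 : ℝ) ≤ k := by exact_mod_cast hk
  apply sin_pos_of_pos_of_lt_pi (by positivity)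
  rw [div_lt_iff₀ (by positivity)]
  nlinarith [pi_pos]

theorem dihedralCoeff_cos_eq {k : ℕ} (hk : 2 ≤ k) (n : ℕ) :
    dihedralCoeff (cos (π / k)) n = sin (n * (π / k)) / sin (π / k) := by
  rw [eq_div_iff (sin_pi_div_pos hk).ne', dihedralCoeff_cos_mul_sin]

theorem dihedralCoeff_nonneg {k : ℕ} (hk : k ≠ 1) {n : ℕ} (hn : k = 0 ∨ n ≤ k) :
    0 ≤ dihedralCoeff (cos (π / k)) n := by
  by_cases h0 : k = 0
  · subst h0; simp [dihedralCoeff_one]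
  have hk2 : 2 ≤ k := by omega
  rw [dihedralCoeff_cos_eq hk2]
  have hn : n ≤ k := by omega
  have hk' : (0 : ℝ) < k := by exact_mod_cast (by omega : 0 < k)
  have hn' : (n : ℝ) ≤ k := by exact_mod_cast hn
  refine div_nonneg (sin_nonneg_of_nonneg_of_le_pi (by positivity) ?_) (sin_pi_div_pos hk2).le
  rw [← mul_div_assoc, div_le_iff₀ hk']
  nlinarith [pi_pos]

theorem dihedralCoeff_self {k : ℕ} (hk : 2 ≤ k) : dihedralCoeff (cos (π / k)) k = 0 := by
  have : (k : ℝ) ≠ 0 := by exact_mod_cast (by omega : k ≠ 0)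
  rw [dihedralCoeff_cos_eq hk, mul_div_cancel₀ _ this]; simp

theorem dihedralCoeff_add_self {k : ℕ} (hk : 2 ≤ k) (n : ℕ) :
    dihedralCoeff (cos (π / k)) (n + k) = -dihedralCoeff (cos (π / k)) n := by
  have : (k : ℝ) ≠ 0 := by exact_mod_cast (by omega : k ≠ 0)
  rw [dihedralCoeff_cos_eq hk, dihedralCoeff_cos_eq hk, Nat.cast_add, add_mul,
    mul_div_cancel₀ _ this, sin_add_pi, neg_div]

theorem dihedralCoeff_pred {k : ℕ} (hk : 2 ≤ k) : dihedralCoeff (cos (π / k)) (k - 1) = 1 := by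
  obtain ⟨j, rfl⟩ := Nat.exists_eq_add_of_le hk
  have h := dihedralCoeff_add_self hk 1
  have h2 : dihedralCoeff (cos (π / (2 + j : ℕ))) (j + 3) =
      2 * cos (π / (2 + j : ℕ)) * dihedralCoeff (cos (π / (2 + j : ℕ))) (j + 2) -
        dihedralCoeff (cos (π / (2 + j : ℕ))) (j + 1) := rfl
  have h3 := dihedralCoeff_self hk
  rw [show 1 + (2 + j) = j + 3 by ring, h2] at h
  rw [show 2 + j - 1 = j + 1 by omega]
  rw [show dihedralCoeff (cos (π / (2 + j : ℕ))) (j + 2) = 0 by rw [add_comm j 2]; exact h3] at h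
  simp only [dihedralCoeff] at h
  linarith

variable {B : Type*} [Fintype B] [DecidableEq B] (M : CoxeterMatrix B)

/-- The Tits form: the bilinear form with `B(e_i, e_j) = -cos (π / M i j)`. A label `0` encodes `∞`
and gives the value `-1`. -/
def titsForm : LinearMap.BilinForm ℝ (B → ℝ) :=
  Matrix.toBilin' (Matrix.of fun i j => -cos (π / M i j))

/-- The simple root attached to `i`. -/
def root (i : B) : B → ℝ := Pi.single i 1

theorem titsForm_root_root (i j : B) : titsForm M (root i) (root j) = -cos (π / M i j) := by
  simp [titsForm, root]

theorem titsForm_root_self (i : B) : titsForm M (root i) (root i) = 1 := by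
  simp [titsForm_root_root]

theorem titsForm_comm (v w : B → ℝ) : titsForm M v w = titsForm M w v := by
  simp only [titsForm, Matrix.toBilin'_apply]
  rw [Finset.sum_comm]
  refine Finset.sum_congr rfl fun i _ => Finset.sum_congr rfl fun j _ => ?_
  simp only [Matrix.of_apply, M.symmetric j i]
  ring

/-- The reflection in the simple root attached to `i`. -/
def reflection (i : B) : Module.End ℝ (B → ℝ) :=
  LinearMap.id - (2 : ℝ) • ((titsForm M).flip (root i)).smulRight (root i)

theorem reflection_apply (i : B) (v : B → ℝ) :
    reflection M i v = v - (2 * titsForm M v (root i)) • root i := by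
  simp [reflection, smul_smul]

theorem reflection_root_self (i : B) : reflection M i (root i) = -root i := by
  rw [reflection_apply, titsForm_root_self]; module

theorem reflection_root (i j : B) :
    reflection M i (root j) = root j + (2 * cos (π / M i j)) • root i := by
  rw [reflection_apply, titsForm_root_root, M.symmetric]; module

theorem reflection_apply_of_ne (i : B) (v : B → ℝ) {j : B} (h : j ≠ i) :
    reflection M i v j = v j := by
  simp [reflection_apply, root, h]

theorem titsForm_reflection (i : B) (v w : B → ℝ) :
    titsForm M (reflection M i v) (reflection M i w) = titsForm M v w := by
  simp only [reflection_apply, map_sub, map_smul, LinearMap.sub_apply, LinearMap.smul_apply,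
    titsForm_root_self, smul_eq_mul, titsForm_comm M (root i) w]
  ring

/-- The letter at position `n` of the alternating sequence `y, x, y, x, …`. -/
def letter {B : Type*} (x y : B) (n : ℕ) : B := if Even n then y else x

omit [Fintype B] [DecidableEq B] in
theorem letter_add_two (x y : B) (n : ℕ) : letter x y (n + 2) = letter x y n := by
  simp [letter, parity_simps]

omit [Fintype B] [DecidableEq B] in
theorem cos_letter (x y : B) (n : ℕ) :
    cos (π / M (letter x y n) (letter x y (n + 1))) = cos (π / M x y) := by
  rcases Nat.even_or_odd n with h | h
  · simp [letter, h, parity_simps, M.symmetric y x]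
  · simp [letter, Nat.not_even_iff_odd.2 h, parity_simps]

/-- The `n`-th root, starting from the simple root of `x`, obtained by applying the simple
reflections of `y`, `x`, `y`, … in turn. -/
def dihedralRoot (x y : B) (n : ℕ) : B → ℝ :=
  dihedralCoeff (cos (π / M x y)) (n + 1) • root (letter x y (n + 1)) +
    dihedralCoeff (cos (π / M x y)) n • root (letter x y n)

theorem reflection_dihedralRoot (x y : B) (n : ℕ) :
    reflection M (letter x y n) (dihedralRoot M x y n) = dihedralRoot M x y (n + 1) := by
  simp only [dihedralRoot, map_add, map_smul, reflection_root_self, reflection_root, cos_letter,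
    letter_add_two, dihedralCoeff]
  module

theorem reflection_pow_dihedralRoot (x y : B) (n : ℕ) :
    ((reflection M x * reflection M y) ^ n) (root x) = dihedralRoot M x y (2 * n) := by
  induction n with
  | zero => simp [dihedralRoot, dihedralCoeff, letter]
  | succ n ih =>
    rw [pow_succ', Module.End.mul_apply, ih, Module.End.mul_apply]
    have h1 := reflection_dihedralRoot M x y (2 * n)
    have h2 := reflection_dihedralRoot M x y (2 * n + 1)
    rw [show letter x y (2 * n) = y by simp [letter]] at h1
    rw [show letter x y (2 * n + 1) = x by simp [letter, parity_simps]] at h2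
    rw [h1, h2]; rfl

theorem reflection_mul_self (i : B) : reflection M i * reflection M i = 1 := by
  refine LinearMap.ext fun v => ?_
  rw [Module.End.mul_apply, Module.End.one_apply, reflection_apply M i v, map_sub, map_smul,
    reflection_root_self, reflection_apply]
  module

theorem reflection_mul_reflection_pow_root {x y : B} (hk : 2 ≤ M x y) :
    ((reflection M x * reflection M y) ^ M x y) (root x) = root x := by
  rw [reflection_pow_dihedralRoot, dihedralRoot,
    show letter x y (2 * M x y + 1) = x by simp [letter, parity_simps],
    show 2 * M x y + 1 = 1 + M x y + M x y by ring, two_mul]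
  simp only [dihedralCoeff_add_self hk, dihedralCoeff_self hk]
  simp [dihedralCoeff]

theorem reflection_liftable : M.IsLiftable (reflection M) := by
  intro x y
  rcases eq_or_ne x y with rfl | hxy
  · rw [M.diagonal, pow_one, reflection_mul_self]
  by_cases h0 : M x y = 0
  · rw [h0, pow_zero]
  have hk : 2 ≤ M x y := by have := M.off_diagonal x y hxy; omega
  have hx := reflection_mul_reflection_pow_root M hk
  have hy : ((reflection M x * reflection M y) ^ M x y) (root y) = root y := by
    have h := reflection_mul_reflection_pow_root M (x := y) (y := x) (M.symmetric x y ▸ hk)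
    have hinv : (reflection M x * reflection M y) * (reflection M y * reflection M x) = 1 := by
      rw [mul_assoc, ← mul_assoc (reflection M y), reflection_mul_self, one_mul,
        reflection_mul_self]
    have hinv' : (reflection M y * reflection M x) * (reflection M x * reflection M y) = 1 := by
      rw [mul_assoc, ← mul_assoc (reflection M x), reflection_mul_self, one_mul,
        reflection_mul_self]
    have hcomm : Commute (reflection M x * reflection M y) (reflection M y * reflection M x) :=
      hinv.trans hinv'.symm
    conv_lhs => rw [← h, M.symmetric y x, ← Module.End.mul_apply, ← hcomm.mul_pow, hinv, one_pow]
    rfl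
  set κ := cos (π / M x y) with hκ
  have hne : 1 - κ ^ 2 ≠ 0 := by
    rw [← sin_sq]; exact (pow_pos (sin_pi_div_pos hk) 2).ne'
  refine LinearMap.ext fun v => ?_
  set p := (titsForm M v (root x) + κ * titsForm M v (root y)) / (1 - κ ^ 2) with hp
  set q := (titsForm M v (root y) + κ * titsForm M v (root x)) / (1 - κ ^ 2) with hq
  have hzx : reflection M x (v - p • root x - q • root y) = v - p • root x - q • root y := by
    rw [reflection_apply]
    simp only [map_sub, map_smul, LinearMap.sub_apply, LinearMap.smul_apply, titsForm_root_root,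
      M.symmetric y x, ← hκ, smul_eq_mul, M.diagonal]
    rw [show titsForm M v (root x) - p * -cos (π / (1 : ℕ)) - q * -κ = 0 by
      simp only [hp, hq]; field_simp; simp; ring]
    simp
  have hzy : reflection M y (v - p • root x - q • root y) = v - p • root x - q • root y := by
    rw [reflection_apply]
    simp only [map_sub, map_smul, LinearMap.sub_apply, LinearMap.smul_apply, titsForm_root_root,
      ← hκ, smul_eq_mul, M.diagonal]
    rw [show titsForm M v (root y) - p * -κ - q * -cos (π / (1 : ℕ)) = 0 by
      simp only [hp, hq]; field_simp; simp; ring]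
    simp
  have hz : ∀ n : ℕ, ((reflection M x * reflection M y) ^ n) (v - p • root x - q • root y) =
      v - p • root x - q • root y := by
    intro n
    induction n with
    | zero => simp
    | succ n ih => rw [pow_succ, Module.End.mul_apply, Module.End.mul_apply, hzy, hzx, ih]
  have := hz (M x y)
  rw [map_sub, map_sub, map_smul, map_smul, hx, hy] at this
  simpa using this

variable {M} {W : Type*} [Group W] (cs : CoxeterSystem M W)

/-- The geometric representation of a Coxeter group. -/
def geomRep : W →* Module.End ℝ (B → ℝ) := cs.lift ⟨reflection M, reflection_liftable M⟩

theorem geomRep_simple (i : B) : geomRep cs (cs.simple i) = reflection M i :=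
  cs.lift_apply_simple (reflection_liftable M) i

theorem geomRep_simple_mul_apply (i : B) (w : W) (v : B → ℝ) :
    geomRep cs (cs.simple i * w) v = reflection M i (geomRep cs w v) := by
  rw [map_mul, Module.End.mul_apply, geomRep_simple]

theorem titsForm_geomRep (g : W) (v w : B → ℝ) :
    titsForm M (geomRep cs g v) (geomRep cs g w) = titsForm M v w := by
  induction g using cs.simple_induction_left with
  | one => simp
  | mul_simple_left g i ih => simp only [geomRep_simple_mul_apply, titsForm_reflection, ih]

open CoxeterSystem (alternatingWord)

omit [Fintype B] [DecidableEq B] in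
theorem wordProd_alternatingWord_succ (x y : B) (n : ℕ) :
    cs.wordProd (alternatingWord x y (n + 1)) =
      cs.wordProd (alternatingWord y x n) * cs.simple y := by
  rw [CoxeterSystem.alternatingWord_succ, cs.wordProd_concat]

omit [Fintype B] [DecidableEq B] in
theorem wordProd_alternatingWord_succ' (x y : B) (n : ℕ) :
    cs.wordProd (alternatingWord x y (n + 1)) =
      cs.simple (letter x y n) * cs.wordProd (alternatingWord x y n) := by
  rw [CoxeterSystem.alternatingWord_succ', cs.wordProd_cons, letter]

theorem geomRep_alternatingWord_root (x y : B) (n : ℕ) :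
    geomRep cs (cs.wordProd (alternatingWord x y n)) (root x) = dihedralRoot M x y n := by
  induction n with
  | zero => simp [alternatingWord, dihedralRoot, dihedralCoeff, letter]
  | succ n ih =>
    rw [wordProd_alternatingWord_succ', geomRep_simple_mul_apply, ih, reflection_dihedralRoot]

omit [Fintype B] [DecidableEq B] in
theorem exists_eq_mul_alternatingWord : ∀ (N : ℕ) (w : W) (x y : B), cs.length w = N →
    cs.length w < cs.length (w * cs.simple x) →
    ∃ (u : W) (n : ℕ), w = u * cs.wordProd (alternatingWord x y n) ∧
      cs.length w = cs.length u + n ∧ cs.length u < cs.length (u * cs.simple x) ∧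
      cs.length u < cs.length (u * cs.simple y) ∧
      (cs.length (w * cs.simple y) < cs.length w → n ≠ 0) := by
  intro N
  induction N with
  | zero =>
    intro w x y hw hx
    refine ⟨w, 0, by simp [alternatingWord], by simp, hx, ?_, by omega⟩
    have := cs.length_mul_simple w y
    omega
  | succ N ih =>
    intro w x y hw hx
    rcases cs.length_mul_simple w y with h | h
    · exact ⟨w, 0, by simp [alternatingWord], by simp, hx, by omega, by omega⟩
    · obtain ⟨u, n, h1, h2, h3, h4, -⟩ := ih (w * cs.simple y) y x (by omega)
        (by rw [cs.simple_mul_simple_cancel_right]; omega)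
      refine ⟨u, n + 1, ?_, by omega, h4, h3, by omega⟩
      rw [wordProd_alternatingWord_succ, ← mul_assoc, ← h1, cs.simple_mul_simple_cancel_right]

omit [Fintype B] [DecidableEq B] in
theorem dihedralRoot_nonneg_coeffs {x y : B} (hxy : x ≠ y) {n : ℕ}
    (hn : M x y = 0 ∨ n + 1 ≤ M x y) :
    0 ≤ dihedralCoeff (cos (π / M x y)) (n + 1) ∧ 0 ≤ dihedralCoeff (cos (π / M x y)) n :=
  ⟨dihedralCoeff_nonneg (M.off_diagonal x y hxy) hn,
    dihedralCoeff_nonneg (M.off_diagonal x y hxy) (by omega)⟩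

theorem geomRep_root_nonneg : ∀ (N : ℕ) (w : W) (x : B), cs.length w = N →
    cs.length w < cs.length (w * cs.simple x) → 0 ≤ geomRep cs w (root x) := by
  intro N
  induction N using Nat.strong_induction_on with
  | _ N ih =>
  intro w x hw hx
  by_cases h1 : w = 1
  · subst h1
    rw [map_one, Module.End.one_apply, root]
    simp
  obtain ⟨y, hy⟩ := cs.exists_rightDescent_of_ne_one h1
  have hy' : cs.length (w * cs.simple y) < cs.length w := hy
  have hxy : x ≠ y := by rintro rfl; omega
  obtain ⟨u, n, hu, hl, hux, huy, hn⟩ := exists_eq_mul_alternatingWord cs _ w x y rfl hx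
  have hn0 := hn hy'
  have hb : M x y = 0 ∨ n + 1 ≤ M x y := by
    by_contra! hcon
    refine cs.not_isReduced_alternatingWord y x (m := n + 1) (by rw [M.symmetric]; exact hcon.1)
      (by rw [M.symmetric]; exact hcon.2) ?_
    have e : w * cs.simple x = u * cs.wordProd (alternatingWord y x (n + 1)) := by
      rw [wordProd_alternatingWord_succ, ← mul_assoc, ← hu]
    have l1 := cs.length_mul_le u (cs.wordProd (alternatingWord y x (n + 1)))
    have l2 := cs.length_wordProd_le (alternatingWord y x (n + 1))
    rw [← e] at l1
    rw [CoxeterSystem.length_alternatingWord] at l2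
    rw [CoxeterSystem.IsReduced, CoxeterSystem.length_alternatingWord]
    omega
  have key : ∀ z, z = x ∨ z = y → 0 ≤ geomRep cs u (root z) := by
    rintro z (rfl | rfl)
    · exact ih _ (by omega) u _ rfl hux
    · exact ih _ (by omega) u _ rfl huy
  have hlet : ∀ j, letter x y j = x ∨ letter x y j = y := by
    intro j; unfold letter; split_ifs <;> simp
  obtain ⟨c1, c2⟩ := dihedralRoot_nonneg_coeffs (M := M) hxy hb
  rw [hu, map_mul, Module.End.mul_apply, geomRep_alternatingWord_root, dihedralRoot, map_add,
    map_smul, map_smul]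
  exact add_nonneg (smul_nonneg c1 (key _ (hlet _))) (smul_nonneg c2 (key _ (hlet _)))

theorem geomRep_root_nonneg_or_nonpos (w : W) (x : B) :
    0 ≤ geomRep cs w (root x) ∨ geomRep cs w (root x) ≤ 0 := by
  rcases cs.length_mul_simple w x with h | h
  · exact Or.inl (geomRep_root_nonneg cs _ w x rfl (by omega))
  · right
    have := geomRep_root_nonneg cs _ (w * cs.simple x) x rfl
      (by rw [cs.simple_mul_simple_cancel_right]; omega)
    rw [map_mul, Module.End.mul_apply, geomRep_simple, reflection_root_self, map_neg] at this
    exact neg_nonneg.1 this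

omit [Fintype B] [DecidableEq B] in
theorem letter_eq_or (x y : B) (n : ℕ) : letter x y n = x ∨ letter x y n = y := by
  unfold letter; split_ifs <;> simp

omit [Fintype B] [DecidableEq B] in
theorem letter_succ (x y : B) (n : ℕ) : letter x y (n + 1) = letter y x n := by
  simp only [letter, Nat.even_add_one]; split_ifs <;> rfl

omit [Fintype B] [DecidableEq B] in
theorem letter_ne_succ {x y : B} (hxy : x ≠ y) (n : ℕ) : letter x y n ≠ letter x y (n + 1) := by
  simp only [letter, Nat.even_add_one]; split_ifs
  · exact hxy.symm
  · exact hxy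

theorem dihedralCoeff_pos {k : ℕ} (hk : 2 ≤ k) {n : ℕ} (h0 : 0 < n) (hn : n < k) :
    0 < dihedralCoeff (cos (π / k)) n := by
  rw [dihedralCoeff_cos_eq hk]
  have hk' : (0 : ℝ) < k := by exact_mod_cast (by omega : 0 < k)
  have hn' : (n : ℝ) < k := by exact_mod_cast hn
  have h0' : (0 : ℝ) < n := by exact_mod_cast h0
  refine div_pos (sin_pos_of_pos_of_lt_pi (by positivity) ?_) (sin_pi_div_pos hk)
  rw [← mul_div_assoc, div_lt_iff₀ hk']
  nlinarith [pi_pos]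

omit [Fintype B] in
theorem root_apply_self (i : B) : root i i = 1 := by simp [root]

omit [Fintype B] in
theorem root_apply_of_ne {i j : B} (h : j ≠ i) : root i j = 0 := by simp [root, h]

omit [Fintype B] in
theorem root_nonneg (i : B) : 0 ≤ root i := by simp [root]

omit [Fintype B] in
theorem root_injective : Function.Injective (root : B → B → ℝ) := by
  intro i j h
  by_contra hne
  have := congrFun h i
  rw [root_apply_self, root_apply_of_ne hne] at this
  exact one_ne_zero this

omit [Fintype B] in
theorem dihedralRoot_apply_letter {x y : B} (hxy : x ≠ y) (n : ℕ) :
    dihedralRoot M x y n (letter x y n) = dihedralCoeff (cos (π / M x y)) n := by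
  simp [dihedralRoot, root_apply_self, root_apply_of_ne (letter_ne_succ hxy n)]

omit [Fintype B] in
theorem dihedralRoot_apply_letter_succ {x y : B} (hxy : x ≠ y) (n : ℕ) :
    dihedralRoot M x y n (letter x y (n + 1)) = dihedralCoeff (cos (π / M x y)) (n + 1) := by
  simp [dihedralRoot, root_apply_self, root_apply_of_ne (letter_ne_succ hxy n).symm]

theorem eq_root_of_support {v : B → ℝ} {x : B} (h0 : 0 ≤ v) (h1 : titsForm M v v = 1)
    (hs : ∀ j, j ≠ x → v j = 0) : v = root x := by
  have hv : v = v x • root x := by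
    ext j
    by_cases hj : j = x
    · subst hj; simp [root_apply_self]
    · simp [hs j hj, root_apply_of_ne hj]
  have hx : v x * v x = 1 := by
    rw [hv] at h1
    simpa [titsForm_root_self, root_apply_self] using h1
  have : v x = 1 := by
    have := h0 x
    simp only [Pi.zero_apply] at this
    nlinarith
  rw [hv, this, one_smul]

theorem titsForm_geomRep_root (w : W) (x : B) :
    titsForm M (geomRep cs w (root x)) (geomRep cs w (root x)) = 1 := by
  rw [titsForm_geomRep, titsForm_root_self]

theorem geomRep_inv_apply (w : W) (v : B → ℝ) : geomRep cs w⁻¹ (geomRep cs w v) = v := by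
  rw [← Module.End.mul_apply, ← map_mul, inv_mul_cancel, map_one, Module.End.one_apply]

theorem geomRep_injective (w : W) : Function.Injective (geomRep cs w) :=
  Function.LeftInverse.injective (geomRep_inv_apply cs w)

theorem geomRep_inv_root_nonneg {u : W} {x : B}
    (h : cs.length u < cs.length (cs.simple x * u)) : 0 ≤ geomRep cs u⁻¹ (root x) := by
  apply geomRep_root_nonneg cs _ _ _ rfl
  have : u⁻¹ * cs.simple x = (cs.simple x * u)⁻¹ := by simp
  rw [this, cs.length_inv, cs.length_inv]
  exact h

theorem geomRep_alternatingWord_mul_apply {x y j : B} (hx : j ≠ x) (hy : j ≠ y) (n : ℕ) (u : W)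
    (v : B → ℝ) :
    geomRep cs (cs.wordProd (alternatingWord x y n) * u) v j = geomRep cs u v j := by
  induction n with
  | zero => simp [alternatingWord]
  | succ n ih =>
    rw [wordProd_alternatingWord_succ', mul_assoc, geomRep_simple_mul_apply,
      reflection_apply_of_ne, ih]
    rcases letter_eq_or x y n with h | h <;> rw [h] <;> assumption

theorem eq_root_or_eq_root_of_mem_plane {x y : B} (hxy : x ≠ y) {u : W}
    (hx : 0 ≤ geomRep cs u⁻¹ (root x)) (hy : 0 ≤ geomRep cs u⁻¹ (root y)) {t : B}
    (hp : ∀ j, j ≠ x → j ≠ y → geomRep cs u (root t) j = 0) :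
    geomRep cs u (root t) = root x ∨ geomRep cs u (root t) = root y := by
  set β := geomRep cs u (root t) with hβ
  have hβ1 : titsForm M β β = 1 := titsForm_geomRep_root cs u t
  have hdec : β = β x • root x + β y • root y := by
    ext j
    by_cases hjx : j = x
    · subst hjx; simp [root_apply_self, root_apply_of_ne hxy]
    by_cases hjy : j = y
    · subst hjy; simp [root_apply_self, root_apply_of_ne hxy.symm]
    simp [root_apply_of_ne hjx, root_apply_of_ne hjy, hp j hjx hjy]
  have ht : root t = β x • geomRep cs u⁻¹ (root x) + β y • geomRep cs u⁻¹ (root y) := by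
    rw [← map_smul, ← map_smul, ← map_add, ← hdec, hβ, geomRep_inv_apply]
  have hβ0 : 0 ≤ β := by
    rcases geomRep_root_nonneg_or_nonpos cs u t with h | h
    · exact h
    · exfalso
      have h1 := congrFun ht t
      rw [root_apply_self, Pi.add_apply, Pi.smul_apply, Pi.smul_apply, smul_eq_mul,
        smul_eq_mul] at h1
      have h2 := mul_nonneg (neg_nonneg.2 (h x)) (hx t)
      have h3 := mul_nonneg (neg_nonneg.2 (h y)) (hy t)
      simp only [← hβ] at h2 h3
      linarith
  by_cases hx0 : β x = 0
  · right
    exact eq_root_of_support hβ0 hβ1 fun j hj => by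
      by_cases hjx : j = x
      · rw [hjx, hx0]
      · exact hp j hjx hj
  by_cases hy0 : β y = 0
  · left
    exact eq_root_of_support hβ0 hβ1 fun j hj => by
      by_cases hjy : j = y
      · rw [hjy, hy0]
      · exact hp j hj hjy
  exfalso
  have hxp : 0 < β x := lt_of_le_of_ne (hβ0 x) (Ne.symm hx0)
  have hyp : 0 < β y := lt_of_le_of_ne (hβ0 y) (Ne.symm hy0)
  have hz : ∀ j, j ≠ t → geomRep cs u⁻¹ (root x) j = 0 ∧ geomRep cs u⁻¹ (root y) j = 0 := by
    intro j hj
    have h1 := congrFun ht j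
    rw [root_apply_of_ne hj, Pi.add_apply, Pi.smul_apply, Pi.smul_apply, smul_eq_mul,
      smul_eq_mul] at h1
    have h2 := hx j
    have h3 := hy j
    simp only [Pi.zero_apply] at h2 h3
    have h4 := mul_nonneg hxp.le h2
    have h5 := mul_nonneg hyp.le h3
    constructor
    · exact (mul_eq_zero.1 (by linarith : β x * _ = 0)).resolve_left hx0
    · exact (mul_eq_zero.1 (by linarith : β y * _ = 0)).resolve_left hy0
  have e1 := eq_root_of_support hx (titsForm_geomRep_root cs _ x) fun j hj => (hz j hj).1
  have e2 := eq_root_of_support hy (titsForm_geomRep_root cs _ y) fun j hj => (hz j hj).2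
  exact hxy (root_injective (geomRep_injective cs u⁻¹ (e1.trans e2.symm)))

omit [Fintype B] [DecidableEq B] in
theorem wordProd_alternatingWord_comm (x y : B) :
    cs.wordProd (alternatingWord x y (M x y)) = cs.wordProd (alternatingWord y x (M x y)) := by
  have := cs.wordProd_braidWord_eq x y
  rwa [CoxeterSystem.braidWord, CoxeterSystem.braidWord, M.symmetric y x] at this

omit [Fintype B] [DecidableEq B] in
theorem simple_mul_alternatingWord {x y z : B} (hk : M x y ≠ 0) (hz : z = x ∨ z = y) {n : ℕ}
    (hn : n ≤ M x y) :
    ∃ n' ≤ M x y,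
      cs.simple z * cs.wordProd (alternatingWord x y n) =
          cs.wordProd (alternatingWord x y n') ∨
        cs.simple z * cs.wordProd (alternatingWord x y n) =
          cs.wordProd (alternatingWord y x n') := by
  have hz' : z = letter x y n ∨ z = letter x y (n + 1) := by
    simp only [letter, Nat.even_add_one]; split_ifs <;> tauto
  rcases hz' with rfl | rfl
  · rcases hn.lt_or_eq with h | h
    · exact ⟨n + 1, h, Or.inl (wordProd_alternatingWord_succ' cs x y n).symm⟩
    · obtain ⟨j, rfl⟩ := Nat.exists_eq_succ_of_ne_zero (h ▸ hk : n ≠ 0)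
      refine ⟨j, by omega, Or.inr ?_⟩
      rw [h, wordProd_alternatingWord_comm, ← h, Nat.succ_eq_add_one,
        wordProd_alternatingWord_succ', letter_succ, cs.simple_mul_simple_cancel_left]
  · cases n with
    | zero =>
      refine ⟨1, by omega, Or.inr ?_⟩
      simp [alternatingWord, letter, CoxeterSystem.wordProd]
    | succ j =>
      refine ⟨j, by omega, Or.inl ?_⟩
      rw [wordProd_alternatingWord_succ', letter_add_two, cs.simple_mul_simple_cancel_left]

omit [Fintype B] [DecidableEq B] in
theorem exists_eq_alternatingWord_mul {x y : B} (hk : M x y ≠ 0) : ∀ (N : ℕ) (v : W),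
    cs.length v = N → ∃ (u : W) (n : ℕ), n ≤ M x y ∧
      cs.length u < cs.length (cs.simple x * u) ∧ cs.length u < cs.length (cs.simple y * u) ∧
      (v = cs.wordProd (alternatingWord x y n) * u ∨
        v = cs.wordProd (alternatingWord y x n) * u) := by
  intro N
  induction N using Nat.strong_induction_on with
  | _ N ih =>
  intro v hv
  by_cases h : ∃ z, (z = x ∨ z = y) ∧ cs.length (cs.simple z * v) < cs.length v
  · obtain ⟨z, hz, hlt⟩ := h
    obtain ⟨u, n, hn, hux, huy, hvu⟩ := ih _ (hv ▸ hlt) (cs.simple z * v) rfl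
    rcases hvu with e | e
    · obtain ⟨n', hn', h'⟩ := simple_mul_alternatingWord cs hk hz hn
      refine ⟨u, n', hn', hux, huy, ?_⟩
      rw [← cs.simple_mul_simple_cancel_left (w := v) z, e, ← mul_assoc]
      exact h'.imp (by rintro h; rw [h]) (by rintro h; rw [h])
    · obtain ⟨n', hn', h'⟩ := simple_mul_alternatingWord cs (x := y) (y := x)
        (M.symmetric x y ▸ hk) hz.symm (M.symmetric x y ▸ hn)
      refine ⟨u, n', M.symmetric x y ▸ hn', hux, huy, ?_⟩
      rw [← cs.simple_mul_simple_cancel_left (w := v) z, e, ← mul_assoc]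
      exact h'.symm.imp (by rintro h; rw [h]) (by rintro h; rw [h])
  · push Not at h
    have hx := h x (Or.inl rfl)
    have hy := h y (Or.inr rfl)
    have hx' := cs.length_simple_mul_ne v x
    have hy' := cs.length_simple_mul_ne v y
    exact ⟨v, 0, by omega, by omega, by omega, by simp [alternatingWord]⟩

/-- `v` sends the simple roots of `T` to nonnegative vectors; equivalently, `v` has minimal length
in its coset `v W_T`. -/
def IsTPositive (T : Set B) (v : W) : Prop := ∀ t ∈ T, 0 ≤ geomRep cs v (root t)

/-- The generator `x` fixes the coset `v W_T`, by carrying a simple root of `T` to that of `x`. -/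
def IsLoop (T : Set B) (x : B) (v : W) : Prop := ∃ t : T, geomRep cs v (root t.1) = root x

variable {cs} {T : Set B}

theorem IsTPositive.simple_mul {v : W} (hv : IsTPositive cs T v) {x : B}
    (hx : ¬ IsLoop cs T x v) : IsTPositive cs T (cs.simple x * v) := by
  intro t ht
  rcases geomRep_root_nonneg_or_nonpos cs (cs.simple x * v) t with h | h
  · exact h
  exfalso
  refine hx ⟨⟨t, ht⟩, eq_root_of_support (hv t ht) (titsForm_geomRep_root cs v t) fun j hj => ?_⟩
  have h1 := h j
  rw [geomRep_simple_mul_apply, reflection_apply_of_ne M x _ hj] at h1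
  exact le_antisymm h1 (hv t ht j)

theorem IsTPositive.not_isLoop_simple_mul {v : W} (hv : IsTPositive cs T v) {x : B} :
    ¬ IsLoop cs T x (cs.simple x * v) := by
  rintro ⟨t, ht⟩
  have h := congrArg (reflection M x) ht
  rw [geomRep_simple_mul_apply, ← Module.End.mul_apply, reflection_mul_self,
    Module.End.one_apply, reflection_root_self] at h
  have h1 := hv t t.2 x
  rw [h, Pi.neg_apply, root_apply_self, Pi.zero_apply] at h1
  linarith

theorem isTPositive_one : IsTPositive cs T 1 := by
  intro t _
  rw [map_one, Module.End.one_apply]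
  exact root_nonneg t

variable (cs T)

/-- The minimal representatives of the cosets of `W_T`. -/
abbrev State := {v : W // IsTPositive cs T v}

variable {G : Type*} [Group G] (σ : T → G)

open Classical in
/-- The generator `x` moves the coset `v W_T` to `x v W_T` and fixes the first component, except
when `x v = v t` with `t ∈ T`: then it multiplies the first component by `σ t`. -/
def step (x : B) : Equiv.Perm (G × State cs T) where
  toFun p := if h : IsLoop cs T x p.2.1 then (σ h.choose * p.1, p.2)
    else (p.1, ⟨cs.simple x * p.2.1, p.2.2.simple_mul h⟩)
  invFun p := if h : IsLoop cs T x p.2.1 then ((σ h.choose)⁻¹ * p.1, p.2)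
    else (p.1, ⟨cs.simple x * p.2.1, p.2.2.simple_mul h⟩)
  left_inv p := by
    by_cases h : IsLoop cs T x p.2.1
    · simp [h]
    · simp [h, p.2.2.not_isLoop_simple_mul]
  right_inv p := by
    by_cases h : IsLoop cs T x p.2.1
    · simp [h]
    · simp [h, p.2.2.not_isLoop_simple_mul]

theorem step_of_isLoop {x : B} {v : State cs T} {t : T} (h : geomRep cs v.1 (root t.1) = root x)
    (a : G) : step cs T σ x (a, v) = (σ t * a, v) := by
  have hl : IsLoop cs T x v.1 := ⟨t, h⟩
  have : hl.choose = t :=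
    Subtype.ext (root_injective (geomRep_injective cs v.1 (hl.choose_spec.trans h.symm)))
  simp only [step, Equiv.coe_fn_mk, hl, dite_true, this]

theorem step_of_not_isLoop {x : B} {v : State cs T} (h : ¬ IsLoop cs T x v.1) (a : G) :
    step cs T σ x (a, v) = (a, ⟨cs.simple x * v.1, v.2.simple_mul h⟩) := by
  simp only [step, Equiv.coe_fn_mk, h, dite_false]

/-- The product `f (L (n - 1)) ⋯ f (L 1) f (L 0)`. -/
def run {A N : Type*} [Monoid N] (f : A → N) (L : ℕ → A) : ℕ → N
  | 0 => 1
  | n + 1 => f (L n) * run f L n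

theorem run_apply_of_trajectory {A S : Type*} (f : A → Equiv.Perm S) (L : ℕ → A) (s : ℕ → S)
    {n : ℕ} (h : ∀ i < n, f (L i) (s i) = s (i + 1)) : run f L n (s 0) = s n := by
  induction n with
  | zero => rfl
  | succ n ih =>
    rw [run, Equiv.Perm.mul_apply, ih fun i hi => h i (by omega), h n (by omega)]

theorem letter_eq_of_parity {A : Type*} (x y : A) {i j : ℕ} (h : Even i ↔ Even j) :
    letter x y i = letter x y j := by
  simp only [letter, h]

/-- Suppose the letters `x` and `y` act on two parallel paths with `k` vertices by alternately
swapping the ends of edges, and exchange the two paths at both extremities. Then the two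
alternating words of length `k` agree on the vertices of the first path. -/
theorem run_letter_comm_of_path {A S : Type*} (f : A → Equiv.Perm S) (x y : A) (s₀ s₁ : ℕ → S)
    {k : ℕ} (up₀ : ∀ i, i + 1 < k → f (letter x y i) (s₀ i) = s₀ (i + 1))
    (up₁ : ∀ i, i + 1 < k → f (letter x y i) (s₁ i) = s₁ (i + 1))
    (down₀ : ∀ i, i + 1 < k → f (letter x y i) (s₀ (i + 1)) = s₀ i)
    (down₁ : ∀ i, i + 1 < k → f (letter x y i) (s₁ (i + 1)) = s₁ i)
    (top : f (letter x y (k - 1)) (s₀ (k - 1)) = s₁ (k - 1))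
    (bot : f x (s₀ 0) = s₁ 0) {n : ℕ} (hn : n < k) :
    run f (letter x y) k (s₀ n) = run f (letter y x) k (s₀ n) := by
  have hup : run f (fun i => letter x y (n + i)) k (s₀ n) = s₁ (k - 1 - n) := by
    have h := run_apply_of_trajectory f (fun i => letter x y (n + i))
      (fun i => if n + i < k then s₀ (n + i) else s₁ (2 * k - 1 - n - i)) (n := k) (by
        intro i hi
        rcases lt_trichotomy (n + i + 1) k with h | h | h
        · rw [if_pos (by omega), if_pos (by omega), up₀ _ h, add_assoc]
        · rw [if_pos (by omega), if_neg (by omega)]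
          rw [show n + i = k - 1 by omega, top]
          congr 1; omega
        · rw [if_neg (by omega), if_neg (by omega)]
          rw [show 2 * k - 1 - n - i = (2 * k - 1 - n - (i + 1)) + 1 by omega,
            letter_eq_of_parity x y (j := 2 * k - 1 - n - (i + 1)) (by rw [Nat.even_iff, Nat.even_iff]; omega)]
          exact down₁ _ (by omega))
    simp only [add_zero, hn, if_true] at h
    rw [h, if_neg (by omega)]
    congr 1; omega
  have hdown : run f (fun i => letter x y (n + 1 + i)) k (s₀ n) = s₁ (k - 1 - n) := by
    have h := run_apply_of_trajectory f (fun i => letter x y (n + 1 + i))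
      (fun i => if i ≤ n then s₀ (n - i) else s₁ (i - n - 1)) (n := k) (by
        intro i hi
        rcases lt_trichotomy i n with h | h | h
        · rw [if_pos (by omega), if_pos (by omega),
            letter_eq_of_parity x y (j := n - (i + 1)) (by rw [Nat.even_iff, Nat.even_iff]; omega),
            show n - i = n - (i + 1) + 1 by omega]
          exact down₀ _ (by omega)
        · subst h
          rw [if_pos le_rfl, if_neg (by omega),
            letter_eq_of_parity x y (j := 1) (by rw [Nat.even_iff, Nat.even_iff]; omega), Nat.sub_self,
            show i + 1 - i - 1 = 0 by omega, ← bot]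
          rfl
        · rw [if_neg (by omega), if_neg (by omega),
            letter_eq_of_parity x y (j := i - n - 1) (by rw [Nat.even_iff, Nat.even_iff]; omega),
            show i + 1 - n - 1 = i - n - 1 + 1 by omega]
          exact up₁ _ (by omega))
    simp only [Nat.zero_le, if_true, Nat.sub_zero] at h
    rw [h, if_neg (by omega)]
    congr 1; omega
  rcases Nat.even_or_odd' n with ⟨q, hq | hq⟩
  · have e1 : (fun i => letter x y (n + i)) = letter x y :=
      funext fun i => letter_eq_of_parity x y (by rw [Nat.even_iff, Nat.even_iff]; omega)
    have e2 : (fun i => letter x y (n + 1 + i)) = letter y x :=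
      funext fun i => (letter_eq_of_parity x y (j := i + 1) (by rw [Nat.even_iff, Nat.even_iff]; omega)).trans (letter_succ x y i)
    rw [e1] at hup
    rw [e2] at hdown
    rw [hup, hdown]
  · have e1 : (fun i => letter x y (n + i)) = letter y x :=
      funext fun i => (letter_eq_of_parity x y (j := i + 1) (by rw [Nat.even_iff, Nat.even_iff]; omega)).trans (letter_succ x y i)
    have e2 : (fun i => letter x y (n + 1 + i)) = letter x y :=
      funext fun i => letter_eq_of_parity x y (by rw [Nat.even_iff, Nat.even_iff]; omega)
    rw [e1] at hup
    rw [e2] at hdown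
    rw [hup, hdown]

theorem run_step_of_forall_not_isLoop {x y : B} (v : State cs T)
    (h : ∀ (n : ℕ) (z : B), z = x ∨ z = y →
      ¬ IsLoop cs T z (cs.wordProd (alternatingWord x y n) * v.1)) (a : G) (n : ℕ) :
    (run (step cs T σ) (letter x y) n (a, v)).1 = a ∧
      (run (step cs T σ) (letter x y) n (a, v)).2.1 =
        cs.wordProd (alternatingWord x y n) * v.1 := by
  induction n with
  | zero => simp [run, alternatingWord]
  | succ n ih =>
    obtain ⟨ih1, ih2⟩ := ih
    rw [run, Equiv.Perm.mul_apply]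
    generalize run (step cs T σ) (letter x y) n (a, v) = p at ih1 ih2 ⊢
    obtain ⟨b, w⟩ := p
    simp only at ih1 ih2
    have hl : ¬ IsLoop cs T (letter x y n) w.1 := ih2 ▸ h n _ (letter_eq_or x y n)
    rw [step_of_not_isLoop _ _ _ hl, wordProd_alternatingWord_succ', mul_assoc, ← ih2]
    exact ⟨ih1, rfl⟩

theorem run_step_comm_of_free {x y : B} {u : W} (hxy : x ≠ y)
    (hux : 0 ≤ geomRep cs u⁻¹ (root x)) (huy : 0 ≤ geomRep cs u⁻¹ (root y))
    (hlx : ¬ IsLoop cs T x u) (hly : ¬ IsLoop cs T y u) (v : State cs T) {n : ℕ}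
    (hv : v.1 = cs.wordProd (alternatingWord x y n) * u) (a : G) :
    run (step cs T σ) (letter x y) (M x y) (a, v) =
      run (step cs T σ) (letter y x) (M x y) (a, v) := by
  have hfree : ∀ (p q z : B), (∀ j, j ≠ x → j ≠ y → j ≠ p ∧ j ≠ q) → (z = x ∨ z = y) →
      ∀ i, ¬ IsLoop cs T z (cs.wordProd (alternatingWord p q i) * v.1) := by
    rintro p q z hpq hz i ⟨t, ht⟩
    have := eq_root_or_eq_root_of_mem_plane cs hxy hux huy (t := t.1) (fun j hjx hjy => by
      rw [← geomRep_alternatingWord_mul_apply cs hjx hjy n, ← hv,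
        ← geomRep_alternatingWord_mul_apply cs (hpq j hjx hjy).1 (hpq j hjx hjy).2 i, ht]
      apply root_apply_of_ne
      rcases hz with rfl | rfl <;> assumption)
    rcases this with h | h
    · exact hlx ⟨t, h⟩
    · exact hly ⟨t, h⟩
  obtain ⟨a1, a2⟩ := run_step_of_forall_not_isLoop cs T σ v
    (fun i z hz => hfree x y z (fun j h1 h2 => ⟨h1, h2⟩) hz i) a (M x y)
  obtain ⟨b1, b2⟩ := run_step_of_forall_not_isLoop cs T σ v
    (fun i z hz => hfree y x z (fun j h1 h2 => ⟨h2, h1⟩) hz.symm i) a (M x y)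
  refine Prod.ext (a1.trans b1.symm) (Subtype.ext ?_)
  rw [a2, b2, wordProd_alternatingWord_comm]

variable {cs T} in
theorem not_isTPositive_alternatingWord_mul {x y : B} (hk : 2 ≤ M x y) (hxy : x ≠ y) {u : W}
    {t : T} (ht : geomRep cs u (root t.1) = root x) {n : ℕ} (hn : n + 1 ≤ M x y) :
    ¬ IsTPositive cs T (cs.wordProd (alternatingWord y x (n + 1)) * u) := by
  intro h
  have h1 := h t t.2
  rw [wordProd_alternatingWord_succ, mul_assoc, map_mul, Module.End.mul_apply,
    geomRep_simple_mul_apply, ht, reflection_root_self, map_neg,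
    geomRep_alternatingWord_root] at h1
  have h2 := h1 (letter x y n)
  have h3 := h1 (letter x y (n + 1))
  rw [Pi.neg_apply, dihedralRoot_apply_letter hxy, Pi.zero_apply] at h2
  rw [Pi.neg_apply, dihedralRoot_apply_letter_succ hxy, Pi.zero_apply] at h3
  rcases Nat.eq_zero_or_pos n with rfl | h0
  · simp [dihedralCoeff] at h3
    linarith
  · have := dihedralCoeff_pos hk h0 (by omega)
    linarith

theorem run_step_comm_of_isLoop_left {x y : B} {u : W} (hk : 2 ≤ M x y) (hxy : x ≠ y)
    (hux : 0 ≤ geomRep cs u⁻¹ (root x)) (huy : 0 ≤ geomRep cs u⁻¹ (root y))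
    {t : T} (ht : geomRep cs u (root t.1) = root x) (hly : ¬ IsLoop cs T y u)
    (hu : IsTPositive cs T u) (v : State cs T) {n : ℕ} (hn : n < M x y)
    (hv : v.1 = cs.wordProd (alternatingWord x y n) * u) (a : G) :
    run (step cs T σ) (letter x y) (M x y) (a, v) =
      run (step cs T σ) (letter y x) (M x y) (a, v) := by
  have hroot : ∀ i, geomRep cs (cs.wordProd (alternatingWord x y i) * u) (root t.1) =
      dihedralRoot M x y i := by
    intro i
    rw [map_mul, Module.End.mul_apply, ht, geomRep_alternatingWord_root]
  have hloop : ∀ i, i + 1 < M x y →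
      ¬ IsLoop cs T (letter x y i) (cs.wordProd (alternatingWord x y i) * u) := by
    rintro i hi ⟨t', ht'⟩
    have := eq_root_or_eq_root_of_mem_plane cs hxy hux huy (t := t'.1) (fun j hjx hjy => by
      rw [← geomRep_alternatingWord_mul_apply cs hjx hjy i, ht']
      apply root_apply_of_ne
      rcases letter_eq_or x y i with h | h <;> rw [h] <;> assumption)
    rcases this with h | h
    · rw [root_injective (geomRep_injective cs u (h.trans ht.symm)), hroot] at ht'
      have h1 := congrFun ht' (letter x y (i + 1))
      rw [dihedralRoot_apply_letter_succ hxy, root_apply_of_ne (letter_ne_succ hxy i).symm] at h1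
      exact (dihedralCoeff_pos hk (Nat.succ_pos i) hi).ne' h1
    · exact hly ⟨t', h⟩
  have hpos : ∀ i < M x y, IsTPositive cs T (cs.wordProd (alternatingWord x y i) * u) := by
    intro i
    induction i with
    | zero => intro _; simpa [alternatingWord] using hu
    | succ i ih =>
      intro hi
      rw [wordProd_alternatingWord_succ', mul_assoc]
      exact (ih (by omega)).simple_mul (hloop i hi)
  have hV : ∃ V : ℕ → State cs T, ∀ i < M x y,
      (V i).1 = cs.wordProd (alternatingWord x y i) * u := by
    classical
    refine ⟨fun i => if h : i < M x y then ⟨_, hpos i h⟩ else v, fun i hi => ?_⟩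
    simp only [hi, dite_true]
  obtain ⟨V, hV⟩ := hV
  have hvn : v = V n := Subtype.ext (hv.trans (hV n hn).symm)
  have hup : ∀ (b : G) i, i + 1 < M x y →
      step cs T σ (letter x y i) (b, V i) = (b, V (i + 1)) := by
    intro b i hi
    rw [step_of_not_isLoop cs T σ (hV i (by omega) ▸ hloop i hi)]
    refine Prod.ext rfl (Subtype.ext ?_)
    simp only
    rw [hV i (by omega), hV (i + 1) hi, wordProd_alternatingWord_succ', mul_assoc]
  have hdown : ∀ (b : G) i, i + 1 < M x y →
      step cs T σ (letter x y i) (b, V (i + 1)) = (b, V i) := by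
    intro b i hi
    have e : (V (i + 1)).1 = cs.simple (letter x y i) * (V i).1 := by
      rw [hV i (by omega), hV (i + 1) hi, wordProd_alternatingWord_succ', mul_assoc]
    rw [step_of_not_isLoop cs T σ (e ▸ (V i).2.not_isLoop_simple_mul)]
    refine Prod.ext rfl (Subtype.ext ?_)
    simp only
    rw [e, cs.simple_mul_simple_cancel_left]
  rw [hvn]
  refine run_letter_comm_of_path (step cs T σ) x y (fun i => (a, V i)) (fun i => (σ t * a, V i))
    (hup a) (hup _) (hdown a) (hdown _) ?_ ?_ hn
  · refine step_of_isLoop cs T σ ?_ a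
    rw [hV _ (by omega), hroot, dihedralRoot, show M x y - 1 + 1 = M x y by omega,
      dihedralCoeff_self hk, dihedralCoeff_pred hk, zero_smul, zero_add, one_smul]
  · refine step_of_isLoop cs T σ ?_ a
    rw [hV _ (by omega)]
    simpa [alternatingWord] using ht

theorem eq_of_cos_pi_div_eq {k j : ℕ} (h : cos (π / k) = cos (π / j)) : k = j := by
  have hmem : ∀ n : ℕ, π / n ∈ Set.Icc 0 π := by
    intro n
    refine ⟨by positivity, ?_⟩
    rcases Nat.eq_zero_or_pos n with rfl | hn
    · simp [pi_pos.le]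
    · exact div_le_self pi_pos.le (by exact_mod_cast hn)
  have := injOn_cos (hmem k) (hmem j) h
  rw [div_eq_mul_inv, div_eq_mul_inv] at this
  exact_mod_cast inv_injective (mul_left_cancel₀ pi_ne_zero this)

theorem run_step_of_isLoop {x y : B} {v : State cs T} {t t' : T}
    (ht : geomRep cs v.1 (root t.1) = root x) (ht' : geomRep cs v.1 (root t'.1) = root y)
    (a : G) (n : ℕ) :
    run (step cs T σ) (letter x y) n (a, v) = (run σ (letter t t') n * a, v) := by
  induction n with
  | zero => simp [run]
  | succ n ih =>
    rw [run, Equiv.Perm.mul_apply, ih, run, mul_assoc]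
    by_cases h : Even n
    · simp only [letter, h, if_true, step_of_isLoop cs T σ ht']
    · simp only [letter, h, if_false, step_of_isLoop cs T σ ht]

theorem isTPositive_of_alternatingWord_mul {x y : B} (hxy : x ≠ y) {u : W}
    (hux : 0 ≤ geomRep cs u⁻¹ (root x)) (huy : 0 ≤ geomRep cs u⁻¹ (root y)) {n : ℕ}
    (hv : IsTPositive cs T (cs.wordProd (alternatingWord x y n) * u)) : IsTPositive cs T u := by
  intro t ht
  rcases geomRep_root_nonneg_or_nonpos cs u t with h | h
  · exact h
  have := eq_root_or_eq_root_of_mem_plane cs hxy hux huy (t := t) (fun j hjx hjy => by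
    refine le_antisymm (h j) ?_
    have := hv t ht j
    rwa [geomRep_alternatingWord_mul_apply cs hjx hjy n] at this)
  rcases this with h | h <;> rw [h] <;> exact root_nonneg _

theorem run_step_comm
    (hσ : ∀ s t : T, s ≠ t → M s.1 t.1 ≠ 0 →
      run σ (letter s t) (M s.1 t.1) = run σ (letter t s) (M s.1 t.1))
    {x y : B} (hxy : x ≠ y) (hk0 : M x y ≠ 0) :
    run (step cs T σ) (letter x y) (M x y) = run (step cs T σ) (letter y x) (M x y) := by
  have hk : 2 ≤ M x y := by have := M.off_diagonal x y hxy; omega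
  have hk' : 2 ≤ M y x := M.symmetric x y ▸ hk
  ext1 ⟨a, v⟩
  obtain ⟨u, n, hn, hlx, hly, hv⟩ := exists_eq_alternatingWord_mul cs hk0 _ v.1 rfl
  have hux := geomRep_inv_root_nonneg cs hlx
  have huy := geomRep_inv_root_nonneg cs hly
  have hu : IsTPositive cs T u := by
    rcases hv with e | e
    · exact isTPositive_of_alternatingWord_mul cs T hxy hux huy (e ▸ v.2)
    · exact isTPositive_of_alternatingWord_mul cs T hxy.symm huy hux (e ▸ v.2)
  have hleft : ∀ {x y : B} (_ : 2 ≤ M x y) (_ : x ≠ y) {t : T}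
      (_ : geomRep cs u (root t.1) = root x) {n : ℕ} (_ : n ≤ M x y)
      (_ : v.1 = cs.wordProd (alternatingWord x y n) * u ∨
        v.1 = cs.wordProd (alternatingWord y x n) * u),
      ∃ n' < M x y, v.1 = cs.wordProd (alternatingWord x y n') * u := by
    intro x y hk hxy t ht n hn hv
    have hback : ∀ j ≤ M x y, v.1 = cs.wordProd (alternatingWord y x j) * u → v.1 = u := by
      intro j hj e
      cases j with
      | zero => simpa [alternatingWord] using e
      | succ j => exact absurd (e ▸ v.2) (not_isTPositive_alternatingWord_mul hk hxy ht hj)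
    have hbase : v.1 = u → ∃ n' < M x y, v.1 = cs.wordProd (alternatingWord x y n') * u :=
      fun e => ⟨0, by omega, by simpa [alternatingWord] using e⟩
    rcases hv with e | e
    · rcases hn.lt_or_eq with h | h
      · exact ⟨n, h, e⟩
      · rw [h, wordProd_alternatingWord_comm] at e
        exact hbase (hback _ le_rfl e)
    · exact hbase (hback _ hn e)
  by_cases hx : IsLoop cs T x u
  · obtain ⟨t, ht⟩ := hx
    obtain ⟨n₁, hn₁, hv₁⟩ := hleft hk hxy ht hn hv
    by_cases hy : IsLoop cs T y u
    · obtain ⟨t', ht'⟩ := hy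
      have hvu : v.1 = u := by
        cases n₁ with
        | zero => simpa [alternatingWord] using hv₁
        | succ j =>
          exact absurd (hv₁ ▸ v.2) (not_isTPositive_alternatingWord_mul hk' hxy.symm ht'
            (M.symmetric x y ▸ hn₁.le))
      rw [← hvu] at ht ht'
      have hM : M t.1 t'.1 = M x y := by
        apply eq_of_cos_pi_div_eq
        rw [← neg_inj, ← titsForm_root_root, ← titsForm_root_root, ← ht, ← ht', titsForm_geomRep]
      rw [run_step_of_isLoop cs T σ ht ht', run_step_of_isLoop cs T σ ht' ht, ← hM,
        hσ t t' _ (hM ▸ hk0)]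
      rintro rfl
      exact hxy (root_injective (ht.symm.trans ht'))
    · exact run_step_comm_of_isLoop_left cs T σ hk hxy hux huy ht hy hu v hn₁ hv₁ a
  · by_cases hy : IsLoop cs T y u
    · obtain ⟨t', ht'⟩ := hy
      obtain ⟨n₁, hn₁, hv₁⟩ := hleft hk' hxy.symm ht' (M.symmetric x y ▸ hn) hv.symm
      have := run_step_comm_of_isLoop_left cs T σ hk' hxy.symm huy hux ht' hx hu v hn₁ hv₁ a
      rw [M.symmetric y x] at this
      exact this.symm
    · rcases hv with e | e
      · exact run_step_comm_of_free cs T σ hxy hux huy hx hy v e a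
      · have := run_step_comm_of_free cs T σ hxy.symm huy hux hy hx v e a
        rw [M.symmetric y x] at this
        exact this.symm

theorem map_altProd {X N : Type*} [Monoid N] (F : FreeGroup X →* N) (n : ℕ) (x y : X) :
    F (altProd n x y) =
      run (fun z => F (FreeGroup.of z)) (if Even n then letter x y else letter y x) n := by
  induction n generalizing x y with
  | zero => simp [altProd, run]
  | succ n ih =>
    rw [altProd, map_mul, ih, run]
    by_cases h : Even n
    · simp [h, Nat.even_add_one, letter]
    · simp [h, Nat.even_add_one, letter]

theorem map_altProd_comm_iff {X N : Type*} [Monoid N] (F : FreeGroup X →* N) (n : ℕ) (x y : X) :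
    F (altProd n x y) = F (altProd n y x) ↔
      run (fun z => F (FreeGroup.of z)) (letter x y) n =
        run (fun z => F (FreeGroup.of z)) (letter y x) n := by
  rw [map_altProd, map_altProd]
  by_cases h : Even n
  · simp only [h, if_true]
  · simp only [h, if_false]
    exact eq_comm

end Coxeter

end

section

open Coxeter

theorem run_artinGen_comm {X : Type*} {m : X → X → ℕ∞} {x y : X} (hxy : x ≠ y) {k : ℕ}
    (hk : m x y = k) : run (artinGen m) (letter x y) k = run (artinGen m) (letter y x) k := by
  refine (map_altProd_comm_iff (PresentedGroup.mk (artinRels m)) k x y).1 ?_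
  rw [← mul_inv_eq_one, ← map_inv, ← map_mul]
  exact PresentedGroup.one_of_mem ⟨x, y, k, hxy, hk, rfl⟩

/-- A family satisfying the braid relations extends to a homomorphism from the Artin group. -/
theorem exists_hom_of_run_comm {X H : Type*} [Group H] {m : X → X → ℕ∞} (f : X → H)
    (hf : ∀ (x y : X) (k : ℕ), x ≠ y → m x y = k →
      run f (letter x y) k = run f (letter y x) k) :
    ∃ Φ : ArtinGroup m →* H, ∀ x, Φ (artinGen m x) = f x := by
  have hrel : ∀ r ∈ artinRels m, FreeGroup.lift f r = 1 := by
    rintro r ⟨x, y, k, hxy, hk, rfl⟩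
    rw [map_mul, map_inv, mul_inv_eq_one, map_altProd_comm_iff]
    simpa only [FreeGroup.lift_apply_of] using hf x y k hxy hk
  exact ⟨PresentedGroup.toGroup hrel, fun x => PresentedGroup.toGroup.of hrel⟩

open Classical in
/-- The Coxeter matrix with the labels `m` off the diagonal, where `0` stands for `⊤`. -/
noncomputable def coxeterMatrixOfLabels {X : Type*} (m : X → X → ℕ∞)
    (hsymm : ∀ x y : X, m x y = m y x) (hge2 : ∀ x y : X, x ≠ y → 2 ≤ m x y) :
    CoxeterMatrix X where
  M := Matrix.of fun x y => if x = y then 1 else (m x y).toNat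
  isSymm := by
    ext x y
    simp only [Matrix.transpose_apply, Matrix.of_apply, hsymm x y, eq_comm]
  diagonal x := by simp
  off_diagonal x y hxy := by
    simp only [Matrix.of_apply, hxy, if_false]
    intro h
    have h2 := hge2 x y hxy
    cases hm : m x y with
    | top => simp [hm] at h
    | coe k =>
      rw [hm] at h h2
      have h2' : 2 ≤ k := by exact_mod_cast h2
      rw [ENat.toNat_natCast] at h
      omega

theorem coxeterMatrixOfLabels_apply {X : Type*} {m : X → X → ℕ∞}
    (hsymm : ∀ x y : X, m x y = m y x) (hge2 : ∀ x y : X, x ≠ y → 2 ≤ m x y) {x y : X}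
    (hxy : x ≠ y) : coxeterMatrixOfLabels m hsymm hge2 x y = (m x y).toNat :=
  if_neg hxy

theorem monoidDist_one {G : Type*} [Group G] (M : Submonoid G) (g : G) :
    monoidDist M 1 g =
      sInf {n : ℕ | ∃ l : List G, l.length = n ∧ (∀ a ∈ l, a ∈ M ∨ a⁻¹ ∈ M) ∧ g = l.prod} := by
  simp only [monoidDist, inv_one, one_mul]

theorem ArtinGroup.closure_range_artinGen {X : Type*} (m : X → X → ℕ∞) :
    Subgroup.closure (Set.range (artinGen m)) = ⊤ :=
  PresentedGroup.closure_range_of _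

/-- An action of `A_Γ` on `A_T × S` in which generators act either on `S` alone or by left
multiplication by a generator of `A_T`, and which extends left multiplication along `ι` on a
base fibre. -/
theorem exists_retraction_action.{u} {X : Type u} [Fintype X] (m : X → X → ℕ∞)
    (hsymm : ∀ x y : X, m x y = m y x) (hge2 : ∀ x y : X, x ≠ y → 2 ≤ m x y) (T : Set X) :
    ∃ (S : Type u) (s₀ : S) (Φ : ArtinGroup m →*
        Equiv.Perm (ArtinGroup (fun s t : T => m s.val t.val) × S)),
      (∀ x p, ∃ b ∈ artinMonoid (fun s t : T => m s.val t.val),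
        (Φ (artinGen m x) p).1 = b * p.1) ∧
      ∀ (t : T) a, Φ (artinGen m t.val) (a, s₀) = (artinGen _ t * a, s₀) := by
  classical
  have cs := (coxeterMatrixOfLabels m hsymm hge2).toCoxeterSystem
  set mT : T → T → ℕ∞ := fun s t => m s.val t.val with hmT
  have hne : ∀ {x y : X} {k : ℕ}, x ≠ y → m x y = k →
      coxeterMatrixOfLabels m hsymm hge2 x y = k := by
    intro x y k hxy h
    rw [coxeterMatrixOfLabels_apply hsymm hge2 hxy, h, ENat.toNat_natCast]
  have hσ : ∀ s t : T, s ≠ t → coxeterMatrixOfLabels m hsymm hge2 s.1 t.1 ≠ 0 →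
      run (artinGen mT) (letter s t) (coxeterMatrixOfLabels m hsymm hge2 s.1 t.1) =
        run (artinGen mT) (letter t s) (coxeterMatrixOfLabels m hsymm hge2 s.1 t.1) := by
    intro s t hst h0
    have hst' : s.1 ≠ t.1 := fun h => hst (Subtype.ext h)
    rw [coxeterMatrixOfLabels_apply hsymm hge2 hst'] at h0 ⊢
    refine run_artinGen_comm hst (ENat.natCast_toNat ?_).symm
    intro htop
    exact h0 (by rw [show m s.1 t.1 = ⊤ from htop, ENat.toNat_top])
  obtain ⟨Φ, hΦ⟩ := exists_hom_of_run_comm (m := m) (step cs T (artinGen mT))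
    fun x y k hxy hk => by
      have h2 := hge2 x y hxy
      rw [hk] at h2
      have h2' : 2 ≤ k := by exact_mod_cast h2
      have := run_step_comm cs T (artinGen mT) hσ hxy (by rw [hne hxy hk]; omega)
      rwa [hne hxy hk] at this
  refine ⟨State cs T, ⟨1, isTPositive_one⟩, Φ, ?_, ?_⟩
  · rintro x ⟨a, v⟩
    rw [hΦ]
    by_cases h : IsLoop cs T x v.1
    · obtain ⟨t, ht⟩ := h
      exact ⟨artinGen mT t, Submonoid.subset_closure ⟨t, rfl⟩, by
        rw [step_of_isLoop cs T _ ht]⟩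
    · exact ⟨1, one_mem _, by rw [step_of_not_isLoop cs T _ h, one_mul]⟩
  · intro t a
    rw [hΦ]
    exact step_of_isLoop cs T _ (by rw [map_one, Module.End.one_apply]) a

end

/-- For a nonempty subset `T ⊆ X`, the canonical homomorphism `ι : A_T → A_Γ`
(sending each generator of `T` to itself) is an isometric embedding of monoid Cayley graphs:
`d_M(e, ι g) = d_{M_T}(e, g)` for all `g ∈ A_T`. -/
theorem artin_special_subgroup_isometric_embedding {X : Type*} [Fintype X] (m : X → X → ℕ∞)
    (hsymm : ∀ x y : X, m x y = m y x) (hge2 : ∀ x y : X, x ≠ y → 2 ≤ m x y)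
    (T : Set X) (hT : T.Nonempty)
    (ι : ArtinGroup (fun s t : T => m s.val t.val) →* ArtinGroup m)
    (hι : ∀ t : T, ι (artinGen (fun s t : T => m s.val t.val) t) = artinGen m t.val) :
    ∀ g : ArtinGroup (fun s t : T => m s.val t.val),
      monoidDist (artinMonoid m) 1 (ι g) =
        monoidDist (artinMonoid (fun s t : T => m s.val t.val)) 1 g := by
  intro g
  obtain ⟨S, s₀, Φ, hgen, hbase⟩ := exists_retraction_action m hsymm hge2 T
  have hpos : ∀ b ∈ artinMonoid m, ∀ p,
      ∃ c ∈ artinMonoid (fun s t : T => m s.val t.val), (Φ b p).1 = c * p.1 := by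
    intro b hb
    induction hb using Submonoid.closure_induction with
    | mem b hb =>
      obtain ⟨x, rfl⟩ := hb
      exact hgen x
    | one => exact fun p => ⟨1, one_mem _, by simp⟩
    | mul b c _ _ ihb ihc =>
      intro p
      obtain ⟨c', hc', ec⟩ := ihc p
      obtain ⟨b', hb', eb⟩ := ihb (Φ c p)
      exact ⟨b' * c', mul_mem hb' hc', by
        rw [map_mul, Equiv.Perm.mul_apply, eb, ec, mul_assoc]⟩
  have hsigned : ∀ b, b ∈ artinMonoid m ∨ b⁻¹ ∈ artinMonoid m → ∀ p,
      ∃ c, (c ∈ artinMonoid (fun s t : T => m s.val t.val) ∨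
        c⁻¹ ∈ artinMonoid (fun s t : T => m s.val t.val)) ∧ (Φ b p).1 = c * p.1 := by
    rintro b (hb | hb) p
    · obtain ⟨c, hc, e⟩ := hpos b hb p
      exact ⟨c, Or.inl hc, e⟩
    · obtain ⟨c, hc, e⟩ := hpos _ hb (Φ b p)
      rw [← Equiv.Perm.mul_apply, ← map_mul, inv_mul_cancel, map_one, Equiv.Perm.one_apply] at e
      exact ⟨c⁻¹, Or.inr (by rwa [inv_inv]), by rw [e, inv_mul_cancel_left]⟩
  have hlist : ∀ l : List (ArtinGroup m), (∀ b ∈ l, b ∈ artinMonoid m ∨ b⁻¹ ∈ artinMonoid m) →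
      ∀ p, ∃ l' : List (ArtinGroup (fun s t : T => m s.val t.val)), l'.length = l.length ∧
        (∀ c ∈ l', c ∈ artinMonoid (fun s t : T => m s.val t.val) ∨
          c⁻¹ ∈ artinMonoid (fun s t : T => m s.val t.val)) ∧
        (Φ l.prod p).1 = l'.prod * p.1 := by
    intro l
    induction l with
    | nil => exact fun _ p => ⟨[], rfl, by simp, by simp⟩
    | cons b l ih =>
      intro hl p
      obtain ⟨l', hlen, hl', e⟩ := ih (fun c hc => hl c (List.mem_cons_of_mem _ hc)) p
      obtain ⟨c, hc, ec⟩ := hsigned b (hl b List.mem_cons_self) (Φ l.prod p)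
      refine ⟨c :: l', by simp [hlen], ?_, ?_⟩
      · rintro d hd
        rcases List.mem_cons.1 hd with rfl | hd
        · exact hc
        · exact hl' d hd
      · rw [List.prod_cons, List.prod_cons, map_mul, Equiv.Perm.mul_apply, ec, e, mul_assoc]
  have hfibre : ∀ h a, Φ (ι h) (a, s₀) = (h * a, s₀) := by
    intro h
    have hh := ArtinGroup.closure_range_artinGen (fun s t : T => m s.val t.val) ▸
      Subgroup.mem_top h
    induction hh using Subgroup.closure_induction with
    | mem h hh =>
      obtain ⟨t, rfl⟩ := hh
      intro a
      rw [hι, hbase]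
    | one => simp
    | mul h k _ _ ihh ihk =>
      intro a
      rw [map_mul, map_mul, Equiv.Perm.mul_apply, ihk, ihh, mul_assoc]
    | inv h _ ih =>
      intro a
      rw [map_inv, map_inv, Equiv.Perm.inv_eq_iff_eq, ih, mul_inv_cancel_left]
  have hmap : artinMonoid (fun s t : T => m s.val t.val) ≤ (artinMonoid m).comap ι := by
    refine Submonoid.closure_le.2 ?_
    rintro _ ⟨t, rfl⟩
    exact Submonoid.mem_comap.2 (hι t ▸ Submonoid.subset_closure ⟨t.1, rfl⟩)
  rw [monoidDist_one, monoidDist_one]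
  congr 1
  ext n
  constructor
  · rintro ⟨l, rfl, hl, e⟩
    obtain ⟨l', hlen, hl', e'⟩ := hlist l hl (1, s₀)
    refine ⟨l', hlen, hl', ?_⟩
    simpa [← e, hfibre] using e'
  · rintro ⟨l, rfl, hl, rfl⟩
    refine ⟨l.map ι, by simp, ?_, map_list_prod ι l⟩
    intro b hb
    obtain ⟨c, hc, rfl⟩ := List.mem_map.1 hb
    rw [← map_inv]
    exact (hl c hc).imp (fun h => hmap h) (fun h => hmap h)
end

section
/- Let $A_\Gamma$ be an Artin group with standard generating set $X$ and let $T \subseteq X$ be a nonempty subset. If the monoid Cayley graph $\mathrm{Cay}(A_T, M_T)$ of the special subgroup $A_T$ has infinite diameter, then the monoid Cayley graph $\mathrm{Cay}(A_\Gamma, M)$ has infinite diameter; that is, if for every $n$ there is $g \in A_T$ with $d_{M_T}(e,g) > n$, then for every $n$ there is $h \in A_\Gamma$ with $d_M(e,h) > n$. -/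
namespace ArtinRetraction

open Real

/-! ### The sequence `sin (n θ) / sin θ` -/

/-- The Chebyshev sequence `u₀ = 0`, `u₁ = 1`, `uₙ₊₂ = c uₙ₊₁ - uₙ`; for `c = 2 cos θ` it is
`sin (n θ) / sin θ`. -/
noncomputable def chebSeq (c : ℝ) : ℕ → ℝ
  | 0 => 0
  | 1 => 1
  | n + 2 => c * chebSeq c (n + 1) - chebSeq c n

lemma chebSeq_mul_sin (θ : ℝ) (n : ℕ) : chebSeq (2 * cos θ) n * sin θ = sin (n * θ) := by
  induction n using Nat.twoStepInduction with
  | zero => simp [chebSeq]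
  | one => simp [chebSeq]
  | more n ih₁ ih₂ =>
    have h₁ : ((n + 1 + 1 : ℕ) : ℝ) * θ = (n + 1 : ℕ) * θ + θ := by push_cast; ring
    have h₂ : (n : ℝ) * θ = (n + 1 : ℕ) * θ - θ := by push_cast; ring
    rw [chebSeq, sub_mul, mul_assoc, ih₁, ih₂, h₁, h₂, sin_add, sin_sub]
    ring

lemma chebSeq_two (n : ℕ) : chebSeq 2 n = n := by
  induction n using Nat.twoStepInduction with
  | zero => simp [chebSeq]
  | one => simp [chebSeq]
  | more n ih₁ ih₂ => rw [chebSeq, ih₁, ih₂]; push_cast; ring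

section Finite

variable {k : ℕ}

lemma sin_pi_div_pos (hk : 2 ≤ k) : 0 < sin (π / k) := by
  have : (1 : ℝ) < k := by exact_mod_cast hk
  exact sin_pos_of_pos_of_lt_pi (by positivity) (div_lt_self pi_pos this)

lemma chebSeq_eq_div (hk : 2 ≤ k) (n : ℕ) :
    chebSeq (2 * cos (π / k)) n = sin (n * (π / k)) / sin (π / k) := by
  rw [eq_div_iff (sin_pi_div_pos hk).ne', chebSeq_mul_sin]

lemma chebSeq_add_period (hk : 2 ≤ k) (n : ℕ) :
    chebSeq (2 * cos (π / k)) (n + 2 * k) = chebSeq (2 * cos (π / k)) n := by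
  have : (k : ℝ) ≠ 0 := by positivity
  have h : ((n + 2 * k : ℕ) : ℝ) * (π / k) = n * (π / k) + 2 * π := by push_cast; field_simp
  rw [chebSeq_eq_div hk, chebSeq_eq_div hk, h, sin_add_two_pi]

lemma chebSeq_sub (hk : 2 ≤ k) {n : ℕ} (hn : n ≤ k) :
    chebSeq (2 * cos (π / k)) (k - n) = chebSeq (2 * cos (π / k)) n := by
  have : (k : ℝ) ≠ 0 := by positivity
  have h : ((k - n : ℕ) : ℝ) * (π / k) = π - n * (π / k) := by push_cast [hn]; field_simp
  rw [chebSeq_eq_div hk, chebSeq_eq_div hk, h, sin_pi_sub]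

lemma chebSeq_pos (hk : 2 ≤ k) {n : ℕ} (h0 : 0 < n) (hn : n < k) :
    0 < chebSeq (2 * cos (π / k)) n := by
  have hk' : (0 : ℝ) < k := by positivity
  have hn' : (n : ℝ) < k := by exact_mod_cast hn
  rw [chebSeq_eq_div hk]
  refine div_pos (sin_pos_of_pos_of_lt_pi (by positivity) ?_) (sin_pi_div_pos hk)
  rw [← mul_div_assoc, div_lt_iff₀ hk', mul_comm]
  exact mul_lt_mul_of_pos_left hn' pi_pos

lemma chebSeq_self (hk : 2 ≤ k) : chebSeq (2 * cos (π / k)) k = 0 := by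
  simpa [chebSeq] using (chebSeq_sub hk (Nat.zero_le k))

lemma chebSeq_succ_self (hk : 2 ≤ k) : chebSeq (2 * cos (π / k)) (k + 1) = -1 := by
  obtain ⟨j, rfl⟩ := Nat.exists_eq_add_of_le' hk
  have h := chebSeq_sub hk (show 1 ≤ j + 2 by omega)
  rw [chebSeq, chebSeq_self hk]
  simp only [Nat.add_succ_sub_one, chebSeq] at h
  rw [h]; ring

lemma chebSeq_det (hk : 2 ≤ k) {i j : ℕ} (hij : i < j) (hj : j < k) :
    0 < chebSeq (2 * cos (π / k)) (i + 1) * chebSeq (2 * cos (π / k)) j -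
      chebSeq (2 * cos (π / k)) i * chebSeq (2 * cos (π / k)) (j + 1) := by
  convert chebSeq_pos hk (show 0 < j - i by omega) (by omega) using 1
  have hs := (sin_pi_div_pos hk).ne'
  simp only [chebSeq_eq_div hk]
  push_cast [hij.le]
  rw [add_mul, add_mul, sub_mul, one_mul, sin_add, sin_add, sin_sub]
  field_simp
  ring

end Finite

lemma chebSeq_nonneg {k n : ℕ} (hk : k ≠ 1) (hn : k = 0 ∨ n ≤ k) :
    0 ≤ chebSeq (2 * cos (π / k)) n := by
  rcases Nat.eq_zero_or_pos k with rfl | hk0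
  · simp [chebSeq_two]
  · have hk2 : 2 ≤ k := by omega
    rcases Nat.eq_zero_or_pos n with rfl | hn0
    · simp [chebSeq]
    · rcases (show n ≤ k by omega).eq_or_lt with rfl | hlt
      · exact (chebSeq_self hk2).ge
      · exact (chebSeq_pos hk2 hn0 hlt).le

/-! ### Alternating products -/

/-- The alternating product `⋯ b a b a` of length `n`, ending with `a`. -/
def altEnd {G : Type*} [Monoid G] : ℕ → G → G → G
  | 0, _, _ => 1
  | n + 1, a, b => altEnd n b a * a

lemma altEnd_succ' {G : Type*} [Monoid G] (n : ℕ) (a b : G) :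
    altEnd (n + 1) a b = (if Even n then a else b) * altEnd n a b := by
  induction n generalizing a b with
  | zero => simp [altEnd]
  | succ n ih =>
    rw [altEnd, ih, altEnd, mul_assoc]
    by_cases h : Even n <;> simp [h, Nat.even_add_one]

lemma altEnd_eq_of_pow {G : Type*} [Group G] {a b : G} (ha : a * a = 1) (hb : b * b = 1) {n : ℕ}
    (h : (a * b) ^ n = 1) : altEnd n a b = altEnd n b a := by
  have key : ∀ (n : ℕ) (a b : G), b * b = 1 → a * a = 1 →
      altEnd n a b * (a * b) ^ n = altEnd n b a := by
    intro n
    induction n with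
    | zero => simp [altEnd]
    | succ n ih =>
      intro a b hb ha
      rw [altEnd, altEnd, pow_succ', mul_assoc, ← mul_assoc a, ← mul_assoc a, ha, one_mul,
        ← mul_pow_mul, ← mul_assoc, ih b a ha hb]
  rw [← key n a b hb ha, h, mul_one]


/-! ### The geometric representation of a Coxeter group -/

section Geometric

set_option linter.unusedSectionVars false

variable {X : Type*} [Fintype X] [DecidableEq X] (M : CoxeterMatrix X)

/-- The number `2 cos (π / M x y)`, with value `2` when `M x y = 0` encodes the label `∞`. -/
noncomputable def coxCos (x y : X) : ℝ := 2 * cos (π / M x y)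

/-- The simple root attached to `x`. -/
def root (x : X) : X → ℝ := Pi.single x 1

/-- The simple coroot attached to `x`. -/
noncomputable def coroot (x : X) : (X → ℝ) →ₗ[ℝ] ℝ :=
  ∑ y, (-coxCos M x y) • LinearMap.proj y

lemma coroot_apply (x : X) (v : X → ℝ) : coroot M x v = ∑ y, -coxCos M x y * v y := by
  simp [coroot]

@[simp] lemma coroot_root (x y : X) : coroot M x (root y) = -coxCos M x y := by
  simp [coroot_apply, root, Pi.single_apply]

@[simp] lemma coxCos_self (x : X) : coxCos M x x = -2 := by simp [coxCos]

lemma coxCos_comm (x y : X) : coxCos M x y = coxCos M y x := by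
  simp [coxCos, M.symmetric x y]

lemma coroot_root_self (x : X) : coroot M x (root x) = 2 := by simp

lemma coxeterMatrix_ne_one {x y : X} (h : x ≠ y) : M x y ≠ 1 := M.off_diagonal x y h

lemma root_injective : Function.Injective (root : X → X → ℝ) := fun x y h => by
  by_contra hne
  simpa [root, hne] using congrFun h x

lemma root_self (x : X) : root x x = 1 := by simp [root]

lemma root_of_ne {x y : X} (h : y ≠ x) : root x y = 0 := by simp [root, h]

lemma root_nonneg (x : X) : 0 ≤ root x := by
  intro y; by_cases h : y = x <;> simp [root, h]

/-- The simple reflection attached to `x`. -/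
noncomputable def refl (x : X) : (X → ℝ) ≃ₗ[ℝ] (X → ℝ) :=
  Module.reflection (coroot_root_self M x)

lemma refl_apply (x : X) (v : X → ℝ) : refl M x v = v - coroot M x v • root x :=
  Module.reflection_apply _ _

lemma refl_mul_self (x : X) : refl M x * refl M x = 1 := by
  ext1 v
  exact Module.involutive_reflection (coroot_root_self M x) v

@[simp] lemma refl_refl (x : X) (v : X → ℝ) : refl M x (refl M x v) = v :=
  Module.involutive_reflection (coroot_root_self M x) v

lemma refl_root_self (x : X) : refl M x (root x) = -root x :=
  Module.reflection_apply_self _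

/-- The `n`-th root of the dihedral subsystem spanned by `x` and `y`, starting from `x`. -/
noncomputable def dihRoot (x y : X) (n : ℕ) : X → ℝ :=
  chebSeq (coxCos M x y) (n + 1) • root x + chebSeq (coxCos M x y) n • root y

@[simp] lemma dihRoot_zero (x y : X) : dihRoot M x y 0 = root x := by simp [dihRoot, chebSeq]

lemma refl_dihRoot (x y : X) (n : ℕ) : refl M x (dihRoot M y x n) = dihRoot M x y (n + 1) := by
  simp only [dihRoot, map_add, map_smul, refl_apply, coroot_root, coxCos_self, chebSeq,
    coxCos_comm M y x]
  module

lemma two_le_of_ne {x y : X} (hxy : x ≠ y) (h0 : M x y ≠ 0) : 2 ≤ M x y := by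
  have := coxeterMatrix_ne_one M hxy; omega

lemma dihRoot_reverse {x y : X} (hxy : x ≠ y) {n : ℕ} (hn : n < M x y) :
    dihRoot M y x (M x y - 1 - n) = dihRoot M x y n := by
  have hk := two_le_of_ne M hxy (by omega)
  rw [dihRoot, dihRoot, coxCos_comm M y x, coxCos, ← chebSeq_sub hk hn.le, ← chebSeq_sub hk hn,
    add_comm, show M x y - 1 - n + 1 = M x y - n by omega,
    show M x y - 1 - n = M x y - (n + 1) by omega]

lemma dihRoot_last {x y : X} (hxy : x ≠ y) (h0 : M x y ≠ 0) :
    dihRoot M x y (M x y - 1) = root y := by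
  have h := dihRoot_reverse M hxy.symm (n := 0) (by rw [M.symmetric]; omega)
  rw [M.symmetric] at h
  simpa using h

lemma dihRoot_label {x y : X} (hxy : x ≠ y) (h0 : M x y ≠ 0) :
    dihRoot M x y (M x y) = -root x := by
  have hk := two_le_of_ne M hxy h0
  simp [dihRoot, coxCos, chebSeq_self hk, chebSeq_succ_self hk]

lemma refl_mul_refl_pow_dihRoot (x y : X) (n k : ℕ) :
    ((refl M x * refl M y) ^ n) (dihRoot M x y k) = dihRoot M x y (k + 2 * n) := by
  induction n with
  | zero => simp
  | succ n ih =>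
    rw [pow_succ', LinearEquiv.mul_apply, ih, LinearEquiv.mul_apply, refl_dihRoot, refl_dihRoot]
    rfl

lemma refl_mul_refl_pow_dihRoot_label {x y : X} (hxy : x ≠ y) (h0 : M x y ≠ 0) (k : ℕ) :
    ((refl M x * refl M y) ^ M x y) (dihRoot M x y k) = dihRoot M x y k := by
  have hk := two_le_of_ne M hxy h0
  rw [refl_mul_refl_pow_dihRoot, dihRoot, dihRoot, coxCos, chebSeq_add_period hk,
    show k + 2 * M x y + 1 = k + 1 + 2 * M x y by ring, chebSeq_add_period hk]

lemma refl_mul_refl_pow_label (x y : X) : (refl M x * refl M y) ^ M x y = 1 := by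
  rcases eq_or_ne x y with rfl | hxy
  · rw [refl_mul_self, one_pow]
  rcases eq_or_ne (M x y) 0 with h0 | h0
  · rw [h0, pow_zero]
  have hx : ((refl M x * refl M y) ^ M x y) (root x) = root x := by
    simpa using refl_mul_refl_pow_dihRoot_label M hxy h0 0
  have hy : ((refl M x * refl M y) ^ M x y) (root y) = root y := by
    simpa [dihRoot_last M hxy h0] using refl_mul_refl_pow_dihRoot_label M hxy h0 (M x y - 1)
  ext1 v
  set c := coxCos M x y with hc
  have hdet : 4 - c ^ 2 ≠ 0 := by
    have := sin_pi_div_pos (two_le_of_ne M hxy h0)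
    have h := sin_sq_add_cos_sq (π / M x y)
    have : 4 - c ^ 2 = 4 * sin (π / M x y) ^ 2 := by rw [hc, coxCos]; linear_combination -4 * h
    rw [this]; positivity
  set p := (2 * coroot M x v + c * coroot M y v) / (4 - c ^ 2) with hp
  set q := (2 * coroot M y v + c * coroot M x v) / (4 - c ^ 2) with hq
  obtain ⟨z, hz⟩ : ∃ z, z = v - p • root x - q • root y := ⟨_, rfl⟩
  have hzx : coroot M x z = 0 := by
    rw [hz]
    simp only [map_sub, map_smul, coroot_root, coxCos_self, ← hc, smul_eq_mul, hp, hq]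
    field_simp; ring
  have hzy : coroot M y z = 0 := by
    rw [hz]
    simp only [map_sub, map_smul, coroot_root, coxCos_self, coxCos_comm M y x, ← hc, smul_eq_mul,
      hp, hq]
    field_simp; ring
  have hfix : ∀ n : ℕ, ((refl M x * refl M y) ^ n) z = z := by
    intro n
    induction n with
    | zero => simp
    | succ n ih =>
      rw [pow_succ', LinearEquiv.mul_apply, ih, LinearEquiv.mul_apply, refl_apply, refl_apply]
      simp [hzx, hzy]
  have hv : v = z + p • root x + q • root y := by rw [hz]; abel
  rw [LinearEquiv.coe_one, id, hv, map_add, map_add, map_smul, map_smul, hfix, hx, hy]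

/-- The geometric representation of the Coxeter group of `M`. -/
noncomputable def geomRep : M.Group →* ((X → ℝ) ≃ₗ[ℝ] (X → ℝ)) :=
  M.toCoxeterSystem.lift ⟨refl M, refl_mul_refl_pow_label M⟩

lemma geomRep_simple (x : X) : geomRep M (M.toCoxeterSystem.simple x) = refl M x :=
  M.toCoxeterSystem.lift_apply_simple (refl_mul_refl_pow_label M) x

/-- The invariant symmetric bilinear form (twice the usual normalization). -/
noncomputable def form (v w : X → ℝ) : ℝ := ∑ x, v x * coroot M x w

lemma form_root_left (x : X) (w : X → ℝ) : form M (root x) w = coroot M x w := by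
  simp [form, root, Pi.single_apply]

lemma form_comm (v w : X → ℝ) : form M v w = form M w v := by
  simp only [form, coroot_apply, Finset.mul_sum]
  rw [Finset.sum_comm]
  refine Finset.sum_congr rfl fun x _ => Finset.sum_congr rfl fun y _ => ?_
  rw [coxCos_comm M y x]; ring

lemma form_smul_left (v w : X → ℝ) (r : ℝ) : form M (r • v) w = r * form M v w := by
  simp [form, Finset.mul_sum, mul_assoc]

lemma form_sub_left (v v' w : X → ℝ) : form M (v - v') w = form M v w - form M v' w := by
  simp [form, sub_mul]

lemma form_refl (x : X) (v w : X → ℝ) : form M (refl M x v) (refl M x w) = form M v w := by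
  rw [refl_apply, form_sub_left, form_smul_left, form_root_left, form_comm M v, refl_apply,
    form_sub_left, form_smul_left, form_root_left, form_comm M w]
  simp; ring

lemma form_of_mem_range {g : (X → ℝ) ≃ₗ[ℝ] (X → ℝ)} (hg : g ∈ (geomRep M).range)
    (v w : X → ℝ) : form M (g v) (g w) = form M v w := by
  obtain ⟨w', rfl⟩ := hg
  induction w' using M.toCoxeterSystem.simple_induction_left with
  | one => simp
  | mul_simple_left u x ih =>
    rw [map_mul, geomRep_simple, LinearEquiv.mul_apply, LinearEquiv.mul_apply, form_refl, ih]


/-! ### Positivity of roots -/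

local notation "cs" => M.toCoxeterSystem

lemma length_altEnd_le (n : ℕ) (x y : X) :
    (cs).length (altEnd n ((cs).simple x) ((cs).simple y)) ≤ n := by
  induction n generalizing x y with
  | zero => simp [altEnd]
  | succ n ih =>
    have h := (cs).length_mul_le (altEnd n ((cs).simple y) ((cs).simple x)) ((cs).simple x)
    rw [(cs).length_simple] at h
    exact h.trans (Nat.add_le_add_right (ih y x) 1)

lemma exists_altEnd_add (n k : ℕ) (x y : X) :
    ∃ c, altEnd (n + k) ((cs).simple x) ((cs).simple y) =
      c * altEnd k ((cs).simple x) ((cs).simple y) ∧ (cs).length c ≤ n := by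
  induction n with
  | zero => exact ⟨1, by simp⟩
  | succ n ih =>
    obtain ⟨c, hc, hl⟩ := ih
    have hz : (if Even (n + k) then (cs).simple x else (cs).simple y) =
        (cs).simple (if Even (n + k) then x else y) := by split_ifs <;> rfl
    refine ⟨(cs).simple (if Even (n + k) then x else y) * c, ?_, ?_⟩
    · rw [show n + 1 + k = n + k + 1 by ring, altEnd_succ', hc, mul_assoc, hz]
    · have h := (cs).length_mul_le ((cs).simple (if Even (n + k) then x else y)) c
      rw [(cs).length_simple] at h
      omega

lemma altEnd_simple_label (x y : X) :
    altEnd (M x y) ((cs).simple x) ((cs).simple y) =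
      altEnd (M x y) ((cs).simple y) ((cs).simple x) :=
  altEnd_eq_of_pow ((cs).simple_mul_simple_self x) ((cs).simple_mul_simple_self y)
    ((cs).simple_mul_simple_pow x y)

lemma geomRep_altEnd_dihRoot (n k : ℕ) (x y : X) :
    geomRep M (altEnd n ((cs).simple x) ((cs).simple y)) (dihRoot M y x k) =
        dihRoot M x y (n + k) ∨
      geomRep M (altEnd n ((cs).simple x) ((cs).simple y)) (dihRoot M y x k) =
        dihRoot M y x (n + k) := by
  induction n generalizing x y k with
  | zero => right; simp [altEnd]
  | succ n ih =>
    rw [altEnd, map_mul, LinearEquiv.mul_apply, geomRep_simple, refl_dihRoot,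
      show n + 1 + k = n + (k + 1) by ring]
    exact (ih (k + 1) y x).symm

/-- A maximal length-additive decomposition `w = v * (⋯ x y)`: no letter of `{x, y}` is a right
descent of `v`. -/
lemma exists_dihedral_decomposition {w : M.Group} {x y : X} (hy : (cs).IsRightDescent w y) :
    ∃ (n : ℕ) (v : M.Group), w = v * altEnd n ((cs).simple y) ((cs).simple x) ∧
      (cs).length v + n = (cs).length w ∧ 1 ≤ n ∧
      (cs).length v < (cs).length (v * (cs).simple x) ∧
      (cs).length v < (cs).length (v * (cs).simple y) := by
  classical
  let P : ℕ → Prop := fun n => ∃ v : M.Group,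
    w = v * altEnd n ((cs).simple y) ((cs).simple x) ∧ (cs).length v + n = (cs).length w
  have hP1 : P 1 := ⟨w * (cs).simple y,
    by rw [altEnd, altEnd, one_mul, (cs).simple_mul_simple_cancel_right], (cs).isRightDescent_iff.1 hy⟩
  have hle : 1 ≤ (cs).length w := by obtain ⟨v, -, hv⟩ := hP1; omega
  obtain ⟨v, hwv, hlen⟩ : P (Nat.findGreatest P ((cs).length w)) := Nat.findGreatest_spec hle hP1
  have hn1 : 1 ≤ Nat.findGreatest P ((cs).length w) := Nat.le_findGreatest hle hP1
  have hmax : ¬ P (Nat.findGreatest P ((cs).length w) + 1) := by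
    intro h
    have hle' : Nat.findGreatest P ((cs).length w) + 1 ≤ (cs).length w := by
      obtain ⟨v', -, hv'⟩ := h; omega
    exact Nat.findGreatest_is_greatest (Nat.lt_succ_self _) hle' h
  generalize Nat.findGreatest P ((cs).length w) = n at hwv hlen hn1 hmax
  have hnext : ¬ (cs).IsRightDescent v (if Even n then y else x) := by
    intro h
    refine hmax ⟨v * (cs).simple (if Even n then y else x), ?_, ?_⟩
    · rw [altEnd_succ', hwv]
      split_ifs <;> simp only [mul_assoc, (cs).simple_mul_simple_cancel_left]
    · have := (cs).isRightDescent_iff.1 h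
      omega
  have hfirst : ¬ (cs).IsRightDescent v (if Even n then x else y) := by
    intro h
    obtain ⟨j, rfl⟩ := Nat.exists_eq_add_of_le' hn1
    have h₁ : w = v * (cs).simple (if Even (j + 1) then x else y) *
        altEnd j ((cs).simple y) ((cs).simple x) := by
      rw [hwv, altEnd_succ', mul_assoc]
      by_cases hj : Even j <;> simp [hj, Nat.even_add_one]
    have h₂ := (cs).length_mul_le (v * (cs).simple (if Even (j + 1) then x else y))
      (altEnd j ((cs).simple y) ((cs).simple x))
    rw [← h₁] at h₂
    have h₃ := length_altEnd_le M j y x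
    have h₄ := (cs).isRightDescent_iff.1 h
    omega
  refine ⟨n, v, hwv, hlen, hn1, ?_⟩
  rw [(cs).not_isRightDescent_iff] at hnext hfirst
  split_ifs at hnext hfirst <;> omega

theorem geomRep_root_nonneg {w : M.Group} {x : X}
    (hx : (cs).length w < (cs).length (w * (cs).simple x)) : 0 ≤ geomRep M w (root x) := by
  induction hN : (cs).length w using Nat.strong_induction_on generalizing w x with
  | _ N ih =>
  rcases eq_or_ne w 1 with rfl | hw
  · simpa using root_nonneg x
  obtain ⟨y, hy⟩ := (cs).exists_rightDescent_of_ne_one hw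
  have hxy : x ≠ y := by
    rintro rfl
    exact absurd hy (not_lt.2 hx.le)
  obtain ⟨n, v, hwv, hlen, hn1, hvx, hvy⟩ := exists_dihedral_decomposition M (x := x) hy
  have hv : ∀ z, (cs).length v < (cs).length (v * (cs).simple z) → 0 ≤ geomRep M v (root z) :=
    fun z hz => ih _ (by omega) hz rfl
  have hn : M x y = 0 ∨ n + 1 ≤ M x y := by
    by_contra! hcon
    obtain ⟨h0, hlt⟩ := hcon
    obtain ⟨j, hj⟩ := Nat.exists_eq_add_of_le (show M x y ≤ n by omega)
    obtain ⟨c, hc, hcl⟩ := exists_altEnd_add M j (M x y) y x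
    obtain ⟨k, hk⟩ := Nat.exists_eq_succ_of_ne_zero h0
    rw [show j + M x y = n by omega, ← altEnd_simple_label, hk, altEnd] at hc
    have h₁ : w * (cs).simple x = v * c * altEnd k ((cs).simple y) ((cs).simple x) := by
      rw [hwv, hc]; simp only [mul_assoc, (cs).simple_mul_simple_self, mul_one]
    have h₂ := (cs).length_mul_le (v * c) (altEnd k ((cs).simple y) ((cs).simple x))
    have h₃ := (cs).length_mul_le v c
    have h₄ := length_altEnd_le M k y x
    rw [← h₁] at h₂
    omega
  have hcoef : ∀ i ≤ n + 1, 0 ≤ chebSeq (coxCos M x y) i := fun i hi =>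
    chebSeq_nonneg (coxeterMatrix_ne_one M hxy) (hn.imp id fun h => hi.trans h)
  have hcomb : ∀ a b : X, (cs).length v < (cs).length (v * (cs).simple a) →
      (cs).length v < (cs).length (v * (cs).simple b) → coxCos M a b = coxCos M x y →
      0 ≤ geomRep M v (dihRoot M a b n) := by
    intro a b ha hb hab
    rw [dihRoot, map_add, map_smul, map_smul, hab]
    exact add_nonneg (smul_nonneg (hcoef _ le_rfl) (hv a ha))
      (smul_nonneg (hcoef _ n.le_succ) (hv b hb))
  have hroot := geomRep_altEnd_dihRoot M n 0 y x
  rw [hwv, map_mul, LinearEquiv.mul_apply]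
  rw [dihRoot_zero, add_zero] at hroot
  rcases hroot with h | h <;> rw [h]
  · exact hcomb y x hvy hvx (coxCos_comm M y x)
  · exact hcomb x y hvx hvy rfl

/-- Every root is either positive or negative. -/
theorem root_image_nonneg_or_nonpos {g : (X → ℝ) ≃ₗ[ℝ] (X → ℝ)} (hg : g ∈ (geomRep M).range)
    (x : X) : 0 ≤ g (root x) ∨ g (root x) ≤ 0 := by
  obtain ⟨w, rfl⟩ := hg
  rcases lt_or_gt_of_ne ((cs).length_mul_simple_ne w x) with h | h
  · right
    have := geomRep_root_nonneg M (w := w * (cs).simple x) (x := x)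
      (by rwa [(cs).simple_mul_simple_cancel_right])
    rw [map_mul, LinearEquiv.mul_apply, geomRep_simple, refl_root_self, map_neg] at this
    exact neg_nonneg.1 this
  · exact Or.inl (geomRep_root_nonneg M h)

lemma refl_mem_range (x : X) : refl M x ∈ (geomRep M).range :=
  ⟨(cs).simple x, geomRep_simple M x⟩

/-- The simple reflection at `x` permutes the positive roots other than the simple root at `x`. -/
lemma refl_image_nonneg {g : (X → ℝ) ≃ₗ[ℝ] (X → ℝ)} (hg : g ∈ (geomRep M).range) {x t : X}
    (hpos : 0 ≤ g (root t)) (hne : g (root t) ≠ root x) : 0 ≤ refl M x (g (root t)) := by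
  refine (root_image_nonneg_or_nonpos M (mul_mem (refl_mem_range M x) hg) t).resolve_right ?_
  intro hneg
  have hzero : ∀ y, y ≠ x → g (root t) y = 0 := by
    intro y hy
    refine le_antisymm ?_ (hpos y)
    simpa [refl_apply, root_of_ne hy] using hneg y
  have hmul : g (root t) = g (root t) x • root x := by
    ext y
    rcases eq_or_ne y x with rfl | hy
    · simp [root_self]
    · simp [hzero y hy, root_of_ne hy]
  have hform := form_of_mem_range M hg (root t) (root t)
  rw [form_root_left, coroot_root_self, hmul, form_smul_left, form_comm, form_smul_left,
    form_root_left, coroot_root_self] at hform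
  have h1 : g (root t) x = 1 := by
    have : (0 : ℝ) ≤ g (root t) x := hpos x
    nlinarith
  exact hne (by rw [hmul, h1]; simp)

/-! ### The action on reduced coset data -/

/-- Linear maps representing the minimal coset representatives of the special subgroup
generated by `T`. -/
def CosetRep (T : Set X) : Type _ :=
  { g : (X → ℝ) ≃ₗ[ℝ] (X → ℝ) // g ∈ (geomRep M).range ∧ ∀ t : T, 0 ≤ g (root t.val) }

section Action

variable {M} {T : Set X} {A : Type*} [Group A] (f : T → A)

lemma image_root_injective (g : CosetRep M T) {t t' : T}
    (h : g.1 (root t.val) = g.1 (root t'.val)) : t = t' :=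
  Subtype.ext (root_injective (g.1.injective h))

open Classical in
/-- Move the coset representative by the simple reflection at `x`, unless `x` fixes the coset, in
which case the `A`-component is multiplied by the corresponding `f t`. -/
noncomputable def step (x : X) (p : CosetRep M T × A) : CosetRep M T × A :=
  if h : ∃ t : T, p.1.1 (root t.val) = root x then (p.1, f h.choose * p.2)
  else (⟨refl M x * p.1.1, mul_mem (refl_mem_range M x) p.1.2.1, fun t =>
    refl_image_nonneg M p.1.2.1 (p.1.2.2 t) fun ht => h ⟨t, ht⟩⟩, p.2)

lemma step_of_eq {x : X} {p : CosetRep M T × A} {t : T} (ht : p.1.1 (root t.val) = root x) :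
    step f x p = (p.1, f t * p.2) := by
  have h : ∃ t : T, p.1.1 (root t.val) = root x := ⟨t, ht⟩
  rw [step, dif_pos h, image_root_injective p.1 (h.choose_spec.trans ht.symm)]

lemma step_of_ne {x : X} {p : CosetRep M T × A} (h : ∀ t : T, p.1.1 (root t.val) ≠ root x) :
    (step f x p).1.1 = refl M x * p.1.1 ∧ (step f x p).2 = p.2 := by
  have h' : ¬ ∃ t : T, p.1.1 (root t.val) = root x := not_exists.2 h
  rw [step, dif_neg h']
  exact ⟨rfl, rfl⟩

lemma root_ne_neg_image (g : CosetRep M T) (t : T) (x : X) : g.1 (root t.val) ≠ -root x := by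
  intro h
  have := g.2.2 t x
  rw [h] at this
  simp only [Pi.zero_apply, Pi.neg_apply, root_self] at this
  linarith

lemma step_step_inv (x : X) (p : CosetRep M T × A) :
    step f x (step (fun t => (f t)⁻¹) x p) = p := by
  by_cases h : ∃ t : T, p.1.1 (root t.val) = root x
  · obtain ⟨t, ht⟩ := h
    rw [step_of_eq (fun t => (f t)⁻¹) ht, step_of_eq f (p := (p.1, (f t)⁻¹ * p.2)) ht]
    simp
  · obtain ⟨h₁, h₂⟩ := step_of_ne (fun t => (f t)⁻¹) (not_exists.1 h)
    obtain ⟨h₃, h₄⟩ := step_of_ne f (x := x) (p := step (fun t => (f t)⁻¹) x p) (by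
      intro t ht
      rw [h₁, LinearEquiv.mul_apply] at ht
      refine root_ne_neg_image p.1 t x ?_
      rw [← refl_root_self M, ← ht, refl_refl])
    refine Prod.ext (Subtype.ext ?_) (h₄.trans h₂)
    rw [h₃, h₁, ← mul_assoc, refl_mul_self, one_mul]

/-- The permutation of the coset data induced by a generator. -/
noncomputable def stepPerm (x : X) : Equiv.Perm (CosetRep M T × A) where
  toFun := step f x
  invFun := step (fun t => (f t)⁻¹) x
  left_inv p := by simpa using step_step_inv (fun t => (f t)⁻¹) x p
  right_inv := step_step_inv f x

lemma altEnd_stepPerm_succ (n : ℕ) (x y : X) (p : CosetRep M T × A) :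
    altEnd (n + 1) (stepPerm f x) (stepPerm f y) p =
      altEnd n (stepPerm f y) (stepPerm f x) (step f x p) := rfl

lemma altEnd_stepPerm_of_forall_ne {n : ℕ} {x y : X} {p : CosetRep M T × A}
    (h : ∀ k < n, ∀ t : T, p.1.1 (root t.val) ≠ dihRoot M x y k) :
    (altEnd n (stepPerm f x) (stepPerm f y) p).2 = p.2 := by
  induction n generalizing x y p with
  | zero => rfl
  | succ n ih =>
    obtain ⟨h₁, h₂⟩ := step_of_ne f (x := x) (p := p) (by simpa using h 0 n.succ_pos)
    rw [altEnd_stepPerm_succ, ih, h₂]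
    intro k hk t ht
    refine h (k + 1) (by omega) t ?_
    rw [← refl_dihRoot, ← ht, h₁, LinearEquiv.mul_apply, refl_refl]

lemma altEnd_stepPerm_of_unique {n : ℕ} {x y : X} (hxy : x ≠ y) (hn : n ≤ M x y)
    {p : CosetRep M T × A} {k₀ : ℕ} (hk₀ : k₀ < n) {t : T}
    (ht : p.1.1 (root t.val) = dihRoot M x y k₀)
    (huniq : ∀ k < M x y, ∀ t' : T, p.1.1 (root t'.val) = dihRoot M x y k → k = k₀) :
    (altEnd n (stepPerm f x) (stepPerm f y) p).2 = f t * p.2 := by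
  induction n generalizing x y p k₀ with
  | zero => omega
  | succ n ih =>
    rw [altEnd_stepPerm_succ]
    rcases Nat.eq_zero_or_pos k₀ with rfl | hpos
    · rw [dihRoot_zero] at ht
      rw [step_of_eq f ht, altEnd_stepPerm_of_forall_ne]
      intro k hk t' ht'
      rw [← dihRoot_reverse M hxy.symm (by rw [M.symmetric]; omega), M.symmetric] at ht'
      have := huniq _ (by omega) t' ht'
      omega
    · have hne : ∀ t' : T, p.1.1 (root t'.val) ≠ root x := fun t' ht' => by
        have := huniq 0 (by omega) t' (by simpa using ht')
        omega
      obtain ⟨h₁, h₂⟩ := step_of_ne f hne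
      rw [← h₂]
      refine ih (k₀ := k₀ - 1) hxy.symm (by rw [M.symmetric]; omega) (by omega) ?_ ?_
      · rw [h₁, LinearEquiv.mul_apply, ht, show k₀ = k₀ - 1 + 1 by omega, ← refl_dihRoot, refl_refl]
        rfl
      · intro k hk t' ht'
        rw [M.symmetric] at hk
        have h₃ : p.1.1 (root t'.val) = dihRoot M x y (k + 1) := by
          rw [← refl_dihRoot, ← ht', h₁, LinearEquiv.mul_apply, refl_refl]
        rcases (show k + 1 ≤ M x y by omega).lt_or_eq with hlt | heq
        · have := huniq _ hlt t' h₃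
          omega
        · rw [heq, dihRoot_label M hxy (by omega)] at h₃
          exact absurd h₃ (root_ne_neg_image p.1 t' x)

lemma altEnd_stepPerm_of_fixed (n : ℕ) {x y : X} {g : CosetRep M T} (a : A) {t t' : T}
    (ht : g.1 (root t.val) = root x) (ht' : g.1 (root t'.val) = root y) :
    altEnd n (stepPerm f x) (stepPerm f y) (g, a) = (g, altEnd n (f t) (f t') * a) := by
  induction n generalizing x y t t' a with
  | zero => simp [altEnd]
  | succ n ih =>
    rw [altEnd_stepPerm_succ, step_of_eq f ht, ih _ ht' ht, altEnd, mul_assoc]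

lemma eq_ends_of_two_images {x y : X} (hxy : x ≠ y) (g : CosetRep M T) {i j : ℕ} (hij : i < j)
    (hj : j < M x y) {t t' : T} (ht : g.1 (root t.val) = dihRoot M x y i)
    (ht' : g.1 (root t'.val) = dihRoot M x y j) : i = 0 ∧ j = M x y - 1 := by
  have hk := two_le_of_ne M hxy (by omega)
  have hdet := chebSeq_det hk hij hj
  have htt' : t.val ≠ t'.val := by
    intro h
    have hroot : dihRoot M x y i = dihRoot M x y j := by rw [← ht, ← ht', h]
    have hx := congrFun hroot x
    have hy := congrFun hroot y
    simp [dihRoot, root_self, root_of_ne hxy, root_of_ne hxy.symm, coxCos] at hx hy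
    rw [hx, hy] at hdet
    linarith
  have hinv : g.1⁻¹ ∈ (geomRep M).range := inv_mem g.2.1
  have hi' : root t.val = chebSeq (coxCos M x y) (i + 1) • g.1⁻¹ (root x) +
      chebSeq (coxCos M x y) i • g.1⁻¹ (root y) := by
    rw [← map_smul, ← map_smul, ← map_add, ← dihRoot, ← ht]
    exact (g.1.symm_apply_apply _).symm
  have hj' : root t'.val = chebSeq (coxCos M x y) (j + 1) • g.1⁻¹ (root x) +
      chebSeq (coxCos M x y) j • g.1⁻¹ (root y) := by
    rw [← map_smul, ← map_smul, ← map_add, ← dihRoot, ← ht']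
    exact (g.1.symm_apply_apply _).symm
  have e₁ := congrFun hi' t.val
  have e₂ := congrFun hi' t'.val
  have e₃ := congrFun hj' t.val
  have e₄ := congrFun hj' t'.val
  simp only [Pi.add_apply, Pi.smul_apply, smul_eq_mul, root_self, root_of_ne htt',
    root_of_ne htt'.symm, coxCos] at e₁ e₂ e₃ e₄
  have dx : (0 ≤ g.1⁻¹ (root x) t.val ∧ 0 ≤ g.1⁻¹ (root x) t'.val) ∨
      (g.1⁻¹ (root x) t.val ≤ 0 ∧ g.1⁻¹ (root x) t'.val ≤ 0) :=
    (root_image_nonneg_or_nonpos M hinv x).imp (fun h => ⟨h _, h _⟩) (fun h => ⟨h _, h _⟩)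
  have dy : (0 ≤ g.1⁻¹ (root y) t.val ∧ 0 ≤ g.1⁻¹ (root y) t'.val) ∨
      (g.1⁻¹ (root y) t.val ≤ 0 ∧ g.1⁻¹ (root y) t'.val ≤ 0) :=
    (root_image_nonneg_or_nonpos M hinv y).imp (fun h => ⟨h _, h _⟩) (fun h => ⟨h _, h _⟩)
  generalize g.1⁻¹ (root x) t.val = p at *
  generalize g.1⁻¹ (root x) t'.val = p' at *
  generalize g.1⁻¹ (root y) t.val = q at *
  generalize g.1⁻¹ (root y) t'.val = q' at *
  constructor
  · by_contra hi0
    have ui := chebSeq_pos hk (show 0 < i by omega) (by omega)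
    have uj := chebSeq_pos hk (show 0 < j by omega) hj
    generalize chebSeq (2 * cos (π / (M x y))) = u at *
    have h₁ : (u (i + 1) * u j - u i * u (j + 1)) * p = u j := by
      linear_combination -u j * e₁ + u i * e₃
    have h₂ : (u (i + 1) * u j - u i * u (j + 1)) * p' = -u i := by
      linear_combination -u j * e₂ + u i * e₄
    rcases dx with ⟨h₃, h₄⟩ | ⟨h₃, h₄⟩
    · nlinarith [mul_nonneg hdet.le h₄]
    · nlinarith [mul_nonneg hdet.le (neg_nonneg.2 h₃)]
  · by_contra hjk
    have ui := chebSeq_pos hk (show 0 < i + 1 by omega) (by omega)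
    have uj := chebSeq_pos hk (show 0 < j + 1 by omega) (by omega)
    generalize chebSeq (2 * cos (π / (M x y))) = u at *
    have h₁ : (u (i + 1) * u j - u i * u (j + 1)) * q = -u (j + 1) := by
      linear_combination u (j + 1) * e₁ - u (i + 1) * e₃
    have h₂ : (u (i + 1) * u j - u i * u (j + 1)) * q' = u (i + 1) := by
      linear_combination u (j + 1) * e₂ - u (i + 1) * e₄
    rcases dy with ⟨h₃, h₄⟩ | ⟨h₃, h₄⟩
    · nlinarith [mul_nonneg hdet.le h₃]
    · nlinarith [mul_nonneg hdet.le (neg_nonneg.2 h₄)]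

lemma label_eq_of_fixed {x y : X} {g : CosetRep M T} {t t' : T}
    (ht : g.1 (root t.val) = root x) (ht' : g.1 (root t'.val) = root y) :
    M t.val t'.val = M x y := by
  have h := form_of_mem_range M g.2.1 (root t.val) (root t'.val)
  rw [ht, ht', form_root_left, form_root_left, coroot_root, coroot_root, neg_inj, coxCos, coxCos,
    mul_right_inj' two_ne_zero] at h
  have hmem : ∀ k : ℕ, π / k ∈ Set.Icc 0 π := fun k => by
    refine ⟨by positivity, ?_⟩
    rcases Nat.eq_zero_or_pos k with rfl | hk
    · simpa using pi_pos.le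
    · exact div_le_self pi_pos.le (by exact_mod_cast hk)
  have := injOn_cos (hmem _) (hmem _) h
  rw [div_eq_mul_inv, div_eq_mul_inv, mul_right_inj' pi_ne_zero, inv_inj] at this
  exact_mod_cast this.symm

variable {f}
variable {r : A →* ((X → ℝ) ≃ₗ[ℝ] (X → ℝ))} (hr : ∀ t : T, r (f t) = refl M t.val)

include hr in
lemma step_equivariant (x : X) (p : CosetRep M T × A) :
    (step f x p).1.1 * r (step f x p).2 = refl M x * (p.1.1 * r p.2) := by
  by_cases h : ∃ t : T, p.1.1 (root t.val) = root x
  · obtain ⟨t, ht⟩ := h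
    rw [step_of_eq f ht, map_mul, hr, ← mul_assoc, ← mul_assoc]
    congr 1
    ext1 v
    have hc : coroot M x (p.1.1 v) = coroot M t.val v := by
      rw [← form_root_left, ← ht, form_of_mem_range M p.1.2.1, form_root_left]
    simp only [LinearEquiv.mul_apply, refl_apply, map_sub, map_smul, ht, hc]
  · obtain ⟨h₁, h₂⟩ := step_of_ne f (not_exists.1 h)
    rw [h₁, h₂, mul_assoc]

include hr in
lemma altEnd_stepPerm_equivariant (n : ℕ) (x y : X) (p : CosetRep M T × A) :
    (altEnd n (stepPerm f x) (stepPerm f y) p).1.1 *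
        r (altEnd n (stepPerm f x) (stepPerm f y) p).2 =
      altEnd n (refl M x) (refl M y) * (p.1.1 * r p.2) := by
  induction n generalizing x y p with
  | zero => simp [altEnd]
  | succ n ih => rw [altEnd_stepPerm_succ, ih, step_equivariant hr, altEnd, mul_assoc]

lemma altEnd_stepPerm_snd
    (hbraid : ∀ t t' : T, t ≠ t' → M t.val t'.val ≠ 0 →
      altEnd (M t.val t'.val) (f t) (f t') = altEnd (M t.val t'.val) (f t') (f t))
    {x y : X} (hxy : x ≠ y) (h0 : M x y ≠ 0) (p : CosetRep M T × A) :
    (altEnd (M x y) (stepPerm f x) (stepPerm f y) p).2 =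
      (altEnd (M x y) (stepPerm f y) (stepPerm f x) p).2 := by
  have hrev : ∀ k < M x y, dihRoot M y x k = dihRoot M x y (M x y - 1 - k) := fun k hk => by
    rw [← dihRoot_reverse M hxy (by omega)]
    congr 1; omega
  by_cases hex : ∃ k < M x y, ∃ t : T, p.1.1 (root t.val) = dihRoot M x y k
  · obtain ⟨k₀, hk₀, t, ht⟩ := hex
    by_cases huniq : ∀ k < M x y, ∀ t' : T, p.1.1 (root t'.val) = dihRoot M x y k → k = k₀
    · rw [altEnd_stepPerm_of_unique f hxy le_rfl hk₀ ht huniq,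
        altEnd_stepPerm_of_unique f hxy.symm (M.symmetric x y).le
          (k₀ := M x y - 1 - k₀) (t := t) (by omega)]
      · rw [ht, dihRoot_reverse M hxy hk₀]
      · intro k hk t' ht'
        rw [M.symmetric] at hk
        rw [hrev k hk] at ht'
        have := huniq _ (by omega) t' ht'
        omega
    · push Not at huniq
      obtain ⟨k₁, hk₁, t', ht', hne⟩ := huniq
      obtain ⟨s, s', hs, hs'⟩ : ∃ s s' : T, p.1.1 (root s.val) = root x ∧
          p.1.1 (root s'.val) = root y := by
        rcases lt_or_gt_of_ne hne with hlt | hlt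
        · obtain ⟨rfl, rfl⟩ := eq_ends_of_two_images hxy p.1 hlt hk₀ ht' ht
          exact ⟨t', t, by simpa using ht', by rw [ht, dihRoot_last M hxy h0]⟩
        · obtain ⟨rfl, rfl⟩ := eq_ends_of_two_images hxy p.1 hlt hk₁ ht ht'
          exact ⟨t, t', by simpa using ht, by rw [ht', dihRoot_last M hxy h0]⟩
      have hss' : s ≠ s' := by
        rintro rfl
        exact hxy (root_injective (hs.symm.trans hs'))
      have hlabel := label_eq_of_fixed hs hs'
      rw [altEnd_stepPerm_of_fixed f _ p.2 hs hs', altEnd_stepPerm_of_fixed f _ p.2 hs' hs,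
        ← hlabel, hbraid s s' hss' (hlabel ▸ h0)]
  · push Not at hex
    rw [altEnd_stepPerm_of_forall_ne f hex, altEnd_stepPerm_of_forall_ne f]
    intro k hk t
    rw [hrev k hk]
    exact hex _ (by omega) t

include hr in
theorem altEnd_stepPerm_label
    (hbraid : ∀ t t' : T, t ≠ t' → M t.val t'.val ≠ 0 →
      altEnd (M t.val t'.val) (f t) (f t') = altEnd (M t.val t'.val) (f t') (f t))
    {x y : X} (hxy : x ≠ y) (h0 : M x y ≠ 0) :
    altEnd (M x y) (stepPerm (M := M) f x) (stepPerm f y) =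
      altEnd (M x y) (stepPerm f y) (stepPerm f x) := by
  ext1 p
  have h₂ := altEnd_stepPerm_snd hbraid hxy h0 p
  refine Prod.ext (Subtype.ext ?_) h₂
  have h₁ := altEnd_stepPerm_equivariant hr (M x y) x y p
  rw [altEnd_eq_of_pow (refl_mul_self M x) (refl_mul_self M y) (refl_mul_refl_pow_label M x y),
    ← altEnd_stepPerm_equivariant hr, h₂] at h₁
  exact mul_right_cancel h₁

end Action

end Geometric

/-! ### Artin groups -/

section Artin

lemma lift_altProd {X G : Type*} [Group G] (φ : X → G) (n : ℕ) (x y : X) :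
    FreeGroup.lift φ (altProd n x y) =
      if Even n then altEnd n (φ y) (φ x) else altEnd n (φ x) (φ y) := by
  induction n generalizing x y with
  | zero => simp [altProd, altEnd]
  | succ n ih =>
    rw [altProd, map_mul, FreeGroup.lift_apply_of, ih, altEnd_succ', altEnd_succ']
    by_cases h : Even n <;> simp [h, Nat.even_add_one]

lemma lift_altProd_eq_iff {X G : Type*} [Group G] (φ : X → G) (n : ℕ) (x y : X) :
    FreeGroup.lift φ (altProd n x y * (altProd n y x)⁻¹) = 1 ↔
      altEnd n (φ x) (φ y) = altEnd n (φ y) (φ x) := by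
  rw [map_mul, map_inv, mul_inv_eq_one, lift_altProd, lift_altProd]
  split_ifs
  · exact eq_comm
  · rfl

lemma artinGen_braid {X : Type*} (m : X → X → ℕ∞) {x y : X} (hxy : x ≠ y) {k : ℕ}
    (hk : m x y = k) :
    altEnd k (artinGen m x) (artinGen m y) = altEnd k (artinGen m y) (artinGen m x) := by
  rw [← lift_altProd_eq_iff (artinGen m)]
  have h : FreeGroup.lift (artinGen m) = PresentedGroup.mk (artinRels m) := by
    ext z; simp [artinGen, PresentedGroup.of]
  rw [h]
  exact PresentedGroup.one_of_mem ⟨x, y, k, hxy, hk, rfl⟩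

/-- The homomorphism from an Artin group determined by images of the generators satisfying the
braid relations. -/
def artinLift {X G : Type*} [Group G] (m : X → X → ℕ∞) (φ : X → G)
    (h : ∀ x y : X, x ≠ y → ∀ k : ℕ, m x y = k → altEnd k (φ x) (φ y) = altEnd k (φ y) (φ x)) :
    ArtinGroup m →* G :=
  PresentedGroup.toGroup (f := φ) (by
    rintro _ ⟨x, y, k, hxy, hk, rfl⟩
    exact (lift_altProd_eq_iff φ k x y).2 (h x y hxy k hk))

lemma artinLift_gen {X G : Type*} [Group G] (m : X → X → ℕ∞) (φ : X → G)
    (h : ∀ x y : X, x ≠ y → ∀ k : ℕ, m x y = k → altEnd k (φ x) (φ y) = altEnd k (φ y) (φ x))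
    (x : X) : artinLift m φ h (artinGen m x) = φ x :=
  PresentedGroup.toGroup.of _

open Classical in
/-- The Coxeter matrix of the labelled graph encoded by `m`. -/
noncomputable def artinCoxeterMatrix {X : Type*} (m : X → X → ℕ∞)
    (hsymm : ∀ x y : X, m x y = m y x) (hge2 : ∀ x y : X, x ≠ y → 2 ≤ m x y) :
    CoxeterMatrix X where
  M := Matrix.of fun x y => if x = y then 1 else (m x y).toNat
  isSymm := Matrix.IsSymm.ext fun x y => by simp [hsymm x y, eq_comm]
  diagonal x := by simp
  off_diagonal x y hxy h := by
    rw [Matrix.of_apply, if_neg hxy, ENat.toNat_eq_iff one_ne_zero] at h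
    have := hge2 x y hxy
    rw [h] at this
    exact absurd this (by norm_num)

section Matrix

variable {X : Type*} {m : X → X → ℕ∞} (hsymm : ∀ x y : X, m x y = m y x)
  (hge2 : ∀ x y : X, x ≠ y → 2 ≤ m x y)

lemma artinCoxeterMatrix_of_label {x y : X} (hxy : x ≠ y) {k : ℕ} (hk : m x y = k) :
    artinCoxeterMatrix m hsymm hge2 x y = k ∧ k ≠ 0 := by
  constructor
  · simp [artinCoxeterMatrix, hxy, hk]
  · rintro rfl
    have := hge2 x y hxy
    rw [hk] at this
    exact absurd this (by norm_num)

lemma label_of_artinCoxeterMatrix {x y : X} (hxy : x ≠ y)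
    (h0 : artinCoxeterMatrix m hsymm hge2 x y ≠ 0) :
    m x y = (artinCoxeterMatrix m hsymm hge2 x y : ℕ) := by
  have h : artinCoxeterMatrix m hsymm hge2 x y = (m x y).toNat := by
    simp [artinCoxeterMatrix, hxy]
  rw [h] at h0 ⊢
  exact ((ENat.toNat_eq_iff h0).1 rfl)

end Matrix

lemma mem_closure_artinGen {X : Type*} (m : X → X → ℕ∞) (g : ArtinGroup m) :
    g ∈ Subgroup.closure (Set.range (artinGen m)) := by
  have : Subgroup.closure (Set.range (artinGen m)) = ⊤ :=
    PresentedGroup.closure_range_of (artinRels m)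
  rw [this]; trivial

lemma exists_list_prod_eq {X : Type*} (m : X → X → ℕ∞) (g : ArtinGroup m) :
    ∃ l : List (ArtinGroup m), (∀ a ∈ l, a ∈ artinMonoid m ∨ a⁻¹ ∈ artinMonoid m) ∧ g = l.prod := by
  have hg := mem_closure_artinGen m g
  rw [← Subgroup.mem_toSubmonoid, Subgroup.closure_toSubmonoid] at hg
  obtain ⟨l, hl, rfl⟩ := Submonoid.exists_list_of_mem_closure hg
  exact ⟨l, fun a ha => (hl a ha).imp (fun h => Submonoid.subset_closure h)
    (fun h => Submonoid.subset_closure h), rfl⟩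

lemma exists_list_length_eq_monoidDist {X : Type*} (m : X → X → ℕ∞) (g : ArtinGroup m) :
    ∃ l : List (ArtinGroup m), l.length = monoidDist (artinMonoid m) 1 g ∧
      (∀ a ∈ l, a ∈ artinMonoid m ∨ a⁻¹ ∈ artinMonoid m) ∧ g = l.prod := by
  obtain ⟨l, hl, hg⟩ := exists_list_prod_eq m g
  have hne : { n : ℕ | ∃ l : List (ArtinGroup m), l.length = n ∧
      (∀ a ∈ l, a ∈ artinMonoid m ∨ a⁻¹ ∈ artinMonoid m) ∧ 1⁻¹ * g = l.prod }.Nonempty :=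
    ⟨l.length, l, rfl, hl, by simpa using hg⟩
  obtain ⟨l', h₁, h₂, h₃⟩ := Nat.sInf_mem hne
  exact ⟨l', h₁, h₂, by simpa using h₃⟩

lemma monoidDist_one_le {G : Type*} [Group G] (N : Submonoid G) {l : List G}
    (hl : ∀ a ∈ l, a ∈ N ∨ a⁻¹ ∈ N) : monoidDist N 1 l.prod ≤ l.length :=
  Nat.sInf_le ⟨l, rfl, hl, by simp⟩

section Retraction

variable {X : Type*} [Fintype X] [DecidableEq X] {M : CoxeterMatrix X} {T : Set X}
  {m : X → X → ℕ∞} {mT : T → T → ℕ∞}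
  {Φ : ArtinGroup m →* Equiv.Perm (CosetRep M T × ArtinGroup mT)}
  (hΦ : ∀ x, Φ (artinGen m x) = stepPerm (artinGen mT) x)

include hΦ in
lemma exists_artinMonoid_action {h : ArtinGroup m} (hh : h ∈ artinMonoid m)
    (p : CosetRep M T × ArtinGroup mT) :
    ∃ a ∈ artinMonoid mT, (Φ h p).2 = a * p.2 := by
  induction hh using Submonoid.closure_induction generalizing p with
  | one => exact ⟨1, one_mem _, by simp⟩
  | mem h hh =>
    obtain ⟨x, rfl⟩ := hh
    have hstep : Φ (artinGen m x) p = step (artinGen mT) x p := by rw [hΦ]; rfl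
    rw [hstep]
    by_cases hx : ∃ t : T, p.1.1 (root t.val) = root x
    · obtain ⟨t, ht⟩ := hx
      exact ⟨artinGen mT t, Submonoid.subset_closure ⟨t, rfl⟩, by rw [step_of_eq _ ht]⟩
    · exact ⟨1, one_mem _, by rw [(step_of_ne _ (not_exists.1 hx)).2, one_mul]⟩
  | mul h₁ h₂ _ _ ih₁ ih₂ =>
    obtain ⟨a₂, ha₂, e₂⟩ := ih₂ p
    obtain ⟨a₁, ha₁, e₁⟩ := ih₁ (Φ h₂ p)
    exact ⟨a₁ * a₂, mul_mem ha₁ ha₂, by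
      rw [map_mul, Equiv.Perm.mul_apply, e₁, e₂, mul_assoc]⟩

include hΦ in
lemma exists_list_action {l : List (ArtinGroup m)}
    (hl : ∀ a ∈ l, a ∈ artinMonoid m ∨ a⁻¹ ∈ artinMonoid m)
    (p : CosetRep M T × ArtinGroup mT) :
    ∃ l' : List (ArtinGroup mT), l'.length = l.length ∧
      (∀ a ∈ l', a ∈ artinMonoid mT ∨ a⁻¹ ∈ artinMonoid mT) ∧
      (Φ l.prod p).2 = l'.prod * p.2 := by
  induction l with
  | nil => exact ⟨[], by simp⟩
  | cons h l ih =>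
    rw [List.forall_mem_cons] at hl
    obtain ⟨l', hlen, hl', e⟩ := ih hl.2
    obtain ⟨a, ha, ea⟩ : ∃ a, (a ∈ artinMonoid mT ∨ a⁻¹ ∈ artinMonoid mT) ∧
        (Φ h (Φ l.prod p)).2 = a * (Φ l.prod p).2 := by
      rcases hl.1 with hh | hh
      · obtain ⟨a, ha, ea⟩ := exists_artinMonoid_action hΦ hh (Φ l.prod p)
        exact ⟨a, Or.inl ha, ea⟩
      · obtain ⟨a, ha, ea⟩ := exists_artinMonoid_action hΦ hh (Φ h (Φ l.prod p))
        refine ⟨a⁻¹, Or.inr (by rwa [inv_inv]), ?_⟩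
        rw [← Equiv.Perm.mul_apply, ← map_mul, inv_mul_cancel, map_one, Equiv.Perm.one_apply] at ea
        rw [ea, inv_mul_cancel_left]
    refine ⟨a :: l', by simp [hlen], List.forall_mem_cons.2 ⟨ha, hl'⟩, ?_⟩
    rw [List.prod_cons, map_mul, Equiv.Perm.mul_apply, ea, e, List.prod_cons, mul_assoc]

/-- The representative of the trivial coset. -/
def trivialCoset (M : CoxeterMatrix X) (T : Set X) : CosetRep M T :=
  ⟨1, one_mem _, fun t => root_nonneg t.val⟩

include hΦ in
lemma exists_action_trivialCoset (g : ArtinGroup mT) :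
    ∃ h : ArtinGroup m, ∀ a, Φ h (trivialCoset M T, a) = (trivialCoset M T, g * a) := by
  have hg := mem_closure_artinGen mT g
  induction hg using Subgroup.closure_induction with
  | mem g hg =>
    obtain ⟨t, rfl⟩ := hg
    refine ⟨artinGen m t, fun a => ?_⟩
    rw [hΦ]
    exact step_of_eq (artinGen mT) (p := (trivialCoset M T, a)) rfl
  | one => exact ⟨1, by simp⟩
  | mul g₁ g₂ _ _ ih₁ ih₂ =>
    obtain ⟨h₁, e₁⟩ := ih₁
    obtain ⟨h₂, e₂⟩ := ih₂
    exact ⟨h₁ * h₂, fun a => by rw [map_mul, Equiv.Perm.mul_apply, e₂, e₁, mul_assoc]⟩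
  | inv g _ ih =>
    obtain ⟨h, e⟩ := ih
    exact ⟨h⁻¹, fun a => by rw [map_inv, Equiv.Perm.inv_eq_iff_eq, e, mul_inv_cancel_left]⟩

end Retraction

end Artin

end ArtinRetraction

open ArtinRetraction

/-- If the monoid Cayley graph of a special subgroup `A_T` has infinite diameter,
then so does the monoid Cayley graph of `A_Γ`. -/
theorem artin_infinite_diameter_of_special_subgroup {X : Type*} [Fintype X] (m : X → X → ℕ∞)
    (hsymm : ∀ x y : X, m x y = m y x) (hge2 : ∀ x y : X, x ≠ y → 2 ≤ m x y)
    (T : Set X) (hT : T.Nonempty)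
    (hsub : ∀ n : ℕ, ∃ g : ArtinGroup (fun s t : T => m s.val t.val),
      n < monoidDist (artinMonoid (fun s t : T => m s.val t.val)) 1 g) :
    ∀ n : ℕ, ∃ h : ArtinGroup m, n < monoidDist (artinMonoid m) 1 h := by
  classical
  intro n
  obtain ⟨g, hg⟩ := hsub n
  let mT : T → T → ℕ∞ := fun s t => m s.val t.val
  let M := artinCoxeterMatrix m hsymm hge2
  have hbraid : ∀ t t' : T, t ≠ t' → M t.val t'.val ≠ 0 →
      altEnd (M t.val t'.val) (artinGen mT t) (artinGen mT t') =
        altEnd (M t.val t'.val) (artinGen mT t') (artinGen mT t) := fun t t' htt' h0 =>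
    artinGen_braid mT htt'
      (label_of_artinCoxeterMatrix hsymm hge2 (fun h => htt' (Subtype.ext h)) h0)
  let r : ArtinGroup mT →* ((X → ℝ) ≃ₗ[ℝ] (X → ℝ)) :=
    artinLift mT (fun t => refl M t.val) fun t t' htt' k hk => by
      obtain ⟨rfl, -⟩ := artinCoxeterMatrix_of_label hsymm hge2
        (fun h => htt' (Subtype.ext h) : t.val ≠ t'.val) hk
      exact altEnd_eq_of_pow (refl_mul_self M _) (refl_mul_self M _)
        (refl_mul_refl_pow_label M t.val t'.val)
  have hr : ∀ t : T, r (artinGen mT t) = refl M t.val := artinLift_gen mT _ _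
  let Φ : ArtinGroup m →* Equiv.Perm (CosetRep M T × ArtinGroup mT) :=
    artinLift m (stepPerm (artinGen mT)) fun x y hxy k hk => by
      obtain ⟨rfl, h0⟩ := artinCoxeterMatrix_of_label hsymm hge2 hxy hk
      exact altEnd_stepPerm_label hr hbraid hxy h0
  have hΦ : ∀ x, Φ (artinGen m x) = stepPerm (artinGen mT) x := artinLift_gen m _ _
  obtain ⟨h, hh⟩ := exists_action_trivialCoset hΦ g
  refine ⟨h, hg.trans_le ?_⟩
  obtain ⟨l, hlen, hl, hprod⟩ := exists_list_length_eq_monoidDist m h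
  obtain ⟨l', hlen', hl', hact⟩ := exists_list_action hΦ hl (trivialCoset M T, 1)
  rw [← hprod, hh, mul_one, mul_one] at hact
  change g = l'.prod at hact
  rw [hact, ← hlen, ← hlen']
  exact monoidDist_one_le _ hl'
end

section
/- Let $A_\Gamma$ be an Artin group with standard generating set $X$ and Artin monoid $M$. If there exist distinct $x, y \in X$ with $m(x,y) = \infty$ (i.e., $\Gamma$ contains a pair of vertices not connected by an edge), then the monoid Cayley graph $\mathrm{Cay}(A_\Gamma, M)$ has infinite diameter; that is, for every $n$ there is $g \in A_\Gamma$ with $d_M(e,g) > n$. -/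
/-! ### Sign changes in free groups -/

section SignChanges

variable {ι : Type*}

/-- The number of sign changes in a word, when it is preceded by a letter of sign `ε`. -/
def signChanges : Bool → List (ι × Bool) → ℕ
  | _, [] => 0
  | ε, p :: w => (if p.2 = ε then 0 else 1) + signChanges p.2 w

theorem signChanges_le_add_one (ε δ : Bool) (w : List (ι × Bool)) :
    signChanges ε w ≤ signChanges δ w + 1 := by
  cases w with
  | nil => simp [signChanges]
  | cons p w => simp only [signChanges]; split_ifs <;> omega

variable [DecidableEq ι]

theorem signChanges_toWord_mk_mul_le (ε : Bool) (i : ι) (g : FreeGroup ι) :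
    signChanges ε (FreeGroup.mk [(i, ε)] * g).toWord ≤ signChanges ε g.toWord := by
  have h : (FreeGroup.mk [(i, ε)] * g).toWord = FreeGroup.reduce ((i, ε) :: g.toWord) := by
    rw [FreeGroup.toWord_mul, FreeGroup.toWord_mk, FreeGroup.reduce_singleton,
      List.singleton_append]
  rw [h, FreeGroup.reduce.cons, FreeGroup.reduce_toWord]
  cases g.toWord with
  | nil => simp [signChanges]
  | cons p w =>
    dsimp only
    split_ifs with hp
    · have := signChanges_le_add_one ε p.2 w
      have hne : p.2 ≠ ε := by rw [hp.2]; cases p.2 <;> decide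
      simp only [signChanges, if_neg hne]
      omega
    · simp [signChanges]

theorem toWord_inv_mul_pow_succ {i j : ι} (hij : i ≠ j) (n : ℕ) :
    (((FreeGroup.of i)⁻¹ * FreeGroup.of j) ^ (n + 1)).toWord =
      (i, false) :: (j, true) :: (((FreeGroup.of i)⁻¹ * FreeGroup.of j) ^ n).toWord := by
  have h (g : FreeGroup ι) : ((FreeGroup.of i)⁻¹ * FreeGroup.of j * g).toWord =
      FreeGroup.reduce ((i, false) :: (j, true) :: g.toWord) := by
    rw [← FreeGroup.toWord_mk]
    conv_lhs => rw [← FreeGroup.mk_toWord (x := g)]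
    rfl
  induction n with
  | zero =>
    rw [pow_succ', h]
    simp [FreeGroup.reduce.cons, hij]
  | succ n ih =>
    rw [pow_succ', h, FreeGroup.reduce.cons, FreeGroup.reduce.cons, FreeGroup.reduce_toWord, ih]
    simp [hij, hij.symm]

theorem le_signChanges_inv_mul_pow {i j : ι} (hij : i ≠ j) (n : ℕ) (ε : Bool) :
    n ≤ signChanges ε (((FreeGroup.of i)⁻¹ * FreeGroup.of j) ^ n).toWord := by
  induction n generalizing ε with
  | zero => simp
  | succ n ih =>
    rw [toWord_inv_mul_pow_succ hij]
    have := ih true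
    simp only [signChanges, Bool.true_eq_false, if_false]
    omega

end SignChanges

/-! ### Counting reflections along alternating words -/

section Hits

variable {W : Type*} [Group W]

open Classical in
/-- The number of `n < k` for which the reflection `(ab)ⁿa` equals `r`. -/
noncomputable def hits (a b r : W) (k : ℕ) : ℕ :=
  ∑ n ∈ Finset.range k, if (a * b) ^ n * a = r then 1 else 0

theorem mul_pow_succ_mul (a b : W) (n : ℕ) :
    (a * b) ^ (n + 1) * a = a * ((b * a) ^ n * b) * a := by
  rw [mul_pow_mul, pow_succ]
  simp only [mul_assoc]

theorem mul_zpow_mul_swap {a b : W} (ha : a * a = 1) (hb : b * b = 1) (n : ℤ) :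
    (b * a) ^ n * b = (a * b) ^ (-n - 1) * a := by
  have hba : b * a = (a * b)⁻¹ := by
    rw [mul_inv_rev, inv_eq_of_mul_eq_one_left ha, inv_eq_of_mul_eq_one_left hb]
  rw [hba, inv_zpow', sub_eq_add_neg, zpow_add, zpow_neg_one, ← hba, mul_assoc, mul_assoc, ha,
    mul_one]

open Classical in
theorem hits_succ {a : W} (ha : a * a = 1) (b r : W) (k : ℕ) :
    hits a b r (k + 1) = hits b a (a * r * a) k + if a = r then 1 else 0 := by
  have ha' : a⁻¹ = a := inv_eq_of_mul_eq_one_left ha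
  rw [hits, Finset.sum_range_succ', hits]
  congr 1
  · refine Finset.sum_congr rfl fun n _ => ?_
    have : (a * b) ^ (n + 1) * a = r ↔ (b * a) ^ n * b = a * r * a := by
      rw [mul_pow_succ_mul]
      constructor
      · rintro rfl
        simp [mul_assoc, ha, ← mul_assoc a a]
      · intro h
        rw [h]
        simp [mul_assoc, ha, ← mul_assoc a a]
    simp only [this]
  · simp

theorem hits_comm {a b : W} (ha : a * a = 1) (hb : b * b = 1) {k : ℕ} (hk : (a * b) ^ k = 1)
    (r : W) : hits a b r k = hits b a r k := by
  classical
  rw [hits, ← Finset.sum_range_reflect, hits]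
  refine Finset.sum_congr rfl fun n hn => ?_
  have hn' : k - 1 - n + (n + 1) = k := by have := Finset.mem_range.1 hn; omega
  have hba : b * a = (a * b)⁻¹ := by
    rw [mul_inv_rev, inv_eq_of_mul_eq_one_left ha, inv_eq_of_mul_eq_one_left hb]
  have h : (a * b) ^ (k - 1 - n) * a = (b * a) ^ n * b := by
    have h1 : (a * b) ^ (k - 1 - n) = (b * a) ^ (n + 1) := by
      rw [hba, inv_pow, eq_inv_iff_mul_eq_one, ← pow_add, hn', hk]
    rw [h1, pow_succ, mul_assoc, mul_assoc, ha, mul_one]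
  rw [h]

end Hits

/-! ### Coxeter groups -/

section Coxeter

open Polynomial Polynomial.Chebyshev Module

theorem Polynomial.Chebyshev.S_eval_two_mul_cos (n : ℤ) (θ : ℝ) :
    (S ℝ n).eval (2 * Real.cos θ) * Real.sin θ = Real.sin ((n + 1) * θ) := by
  rw [← U_real_cos, ← S_comp_two_mul_X]
  simp

theorem Module.reflection_mul_reflection_pow_eq_one {V : Type*} [AddCommGroup V] [Module ℝ V]
    {v w : V} {f g : Dual ℝ V} (hf : f v = 2) (hg : g w = 2) {k : ℕ} (hk : 2 ≤ k)
    (hfw : f w = -2 * Real.cos (Real.pi / k)) (hgv : g v = -2 * Real.cos (Real.pi / k)) :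
    (reflection hf * reflection hg) ^ k = 1 := by
  ext z
  rcases hk.eq_or_lt with rfl | hk
  · have h0 : Real.cos (Real.pi / (2 : ℕ)) = 0 := by simp
    rw [h0, mul_zero] at hfw hgv
    simp only [pow_two, LinearEquiv.mul_apply, reflection_apply, map_sub, map_smul, hf, hg, hfw,
      hgv, LinearEquiv.coe_one, id]
    module
  · have hk0 : (k : ℝ) ≠ 0 := by positivity
    set θ : ℝ := 2 * Real.pi / k with hθ
    have hkθ : k * θ = 2 * Real.pi := by rw [hθ]; field_simp
    have ht : 2 * Real.cos θ = f w * g v - 2 := by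
      rw [hfw, hgv, hθ, mul_div_assoc, Real.cos_two_mul]
      ring
    have hsin : Real.sin θ ≠ 0 := by
      have hk3 : (3 : ℝ) ≤ k := by exact_mod_cast hk
      refine (Real.sin_pos_of_pos_of_lt_pi (by positivity) ?_).ne'
      rw [hθ, div_lt_iff₀ (by positivity)]
      nlinarith [Real.pi_pos]
    rw [reflection_mul_reflection_pow_apply hf hg k z _ ht, LinearEquiv.coe_one, id]
    rcases Nat.even_or_odd' k with ⟨j, rfl | rfl⟩
    · have h1 : (((2 * j : ℕ) : ℤ) - 2) / 2 = (j : ℤ) - 1 := by omega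
      have h2 : (((2 * j : ℕ) : ℤ) - 1) / 2 = (j : ℤ) - 1 := by omega
      have hS : (S ℝ ((j : ℤ) - 1)).eval (2 * Real.cos θ) = 0 := by
        refine (mul_eq_zero_iff_right hsin).1 ?_
        rw [S_eval_two_mul_cos]
        have : (((j : ℤ) - 1 : ℤ) + 1 : ℝ) * θ = Real.pi := by
          push_cast at hkθ ⊢
          linarith
        rw [this, Real.sin_pi]
      rw [h1, h2, hS]
      simp
    · have h1 : (((2 * j + 1 : ℕ) : ℤ) - 2) / 2 = (j : ℤ) - 1 := by omega
      have h2 : (((2 * j + 1 : ℕ) : ℤ) - 1) / 2 = (j : ℤ) := by omega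
      have h3 : (((2 * j + 1 : ℕ) : ℤ) - 3) / 2 = (j : ℤ) - 1 := by omega
      have h4 : (((2 * j + 1 : ℕ) : ℤ)) / 2 = (j : ℤ) := by omega
      have hS : (S ℝ (j : ℤ)).eval (2 * Real.cos θ) +
          (S ℝ ((j : ℤ) - 1)).eval (2 * Real.cos θ) = 0 := by
        refine (mul_eq_zero_iff_right hsin).1 ?_
        rw [add_mul, S_eval_two_mul_cos, S_eval_two_mul_cos]
        have : (((j : ℤ) - 1 : ℤ) + 1 : ℝ) * θ = 2 * Real.pi - ((j : ℤ) + 1) * θ := by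
          push_cast at hkθ ⊢
          linarith
        rw [this, Real.sin_two_pi_sub, add_neg_cancel]
      rw [h1, h2, h3, h4, hS]
      simp

theorem exists_involutions_of_labels {X : Type*} (m : X → X → ℕ∞)
    (hsymm : ∀ x y : X, m x y = m y x) (hge2 : ∀ x y : X, x ≠ y → 2 ≤ m x y) :
    ∃ f : X → ((X →₀ ℝ) ≃ₗ[ℝ] (X →₀ ℝ)), (∀ x, f x * f x = 1) ∧
      (∀ (x y : X) (k : ℕ), x ≠ y → m x y = k → (f x * f y) ^ k = 1) ∧
      ∀ x y : X, x ≠ y → m x y = ⊤ → ¬ IsOfFinOrder (f x * f y) := by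
  classical
  let a (x y : X) : ℝ := if x = y then 2 else -2 * Real.cos (Real.pi / (m x y).toNat)
  let c (x : X) : Dual ℝ (X →₀ ℝ) := Finsupp.linearCombination ℝ (a x)
  have hc (x y : X) : c x (Finsupp.single y 1) = a x y := by simp [c]
  have hc2 (x : X) : c x (Finsupp.single x 1) = 2 := by simp [hc, a]
  refine ⟨fun x => reflection (hc2 x), fun x => ?_, fun x y k hxy hk => ?_, fun x y hxy h => ?_⟩
  · ext1 v
    exact involutive_reflection (hc2 x) v
  · refine reflection_mul_reflection_pow_eq_one _ _ ?_ ?_ ?_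
    · have := hge2 x y hxy
      rw [hk] at this
      exact_mod_cast this
    · simp [hc, a, hxy, hk]
    · simp [hc, a, hxy.symm, hsymm y x, hk]
  · have hxy' : c x (Finsupp.single y 1) = -2 := by simp [hc, a, hxy, h]
    have hyx' : c y (Finsupp.single x 1) = -2 := by simp [hc, a, hxy.symm, hsymm y x, h]
    rw [isOfFinOrder_iff_pow_eq_one]
    rintro ⟨n, hn, h1⟩
    have h2 := reflection_reflection_iterate (hc2 x) (hc2 y) (by rw [hxy', hyx']; norm_num) n
    have h3 : ((reflection (hc2 y)).trans (reflection (hc2 x)))^[n] (Finsupp.single y 1) =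
        Finsupp.single y 1 := by
      have := congrArg (fun e => e (Finsupp.single y (1 : ℝ))) h1
      simp only [LinearEquiv.coe_one, id] at this
      rwa [hom_coe_pow (fun e : (X →₀ ℝ) ≃ₗ[ℝ] (X →₀ ℝ) => (e : (X →₀ ℝ) → (X →₀ ℝ))) rfl
        (fun _ _ => rfl)] at this
    rw [h3, left_eq_add, hxy', smul_eq_zero] at h2
    have h4 := congrArg (fun v => v x) (h2.resolve_left hn.ne')
    simp [hxy] at h4

end Coxeter

/-! ### The action on tracked tuples of reflections -/

section Track

variable {ι W : Type*} [Group W]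

variable (ι W) in
/-- Tuples of group elements whose pairwise products have infinite order. -/
abbrev Track : Type _ := {r : ι → W // Pairwise fun i j => ¬ IsOfFinOrder (r i * r j)}

namespace Track

/-- Simultaneous conjugation of a tuple. -/
def conj (r : Track ι W) (w : W) : Track ι W :=
  ⟨fun i => w⁻¹ * r.1 i * w, fun i j hij h => r.2 hij <| by
    refine IsConj.isOfFinOrder (isConj_iff.2 ⟨w, ?_⟩) h
    group⟩

theorem conj_conj (r : Track ι W) (v w : W) : (r.conj v).conj w = r.conj (v * w) :=
  Subtype.ext <| funext fun i => by simp only [conj]; group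

@[simp]
theorem conj_one (r : Track ι W) : r.conj 1 = r :=
  Subtype.ext <| funext fun i => by simp [conj]

theorem conj_apply_of_mul_self {s : W} (hs : s * s = 1) (r : Track ι W) (i : ι) :
    (r.conj s).1 i = s * r.1 i * s := by
  simp only [conj, inv_eq_of_mul_eq_one_left hs]

theorem conj_apply_eq_iff {s : W} (r : Track ι W) (i : ι) :
    (r.conj s).1 i = s ↔ r.1 i = s := by
  simp only [conj, mul_eq_right, inv_mul_eq_one]
  exact eq_comm

theorem eq_of_apply_eq {s : W} (hs : s * s = 1) {r : Track ι W} {i j : ι} (hi : r.1 i = s)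
    (hj : r.1 j = s) : i = j := by
  by_contra hij
  exact r.2 hij (by rw [hi, hj, hs]; exact IsOfFinOrder.one)

open Classical in
/-- The permutation attached to an involution `s`: tuples having `s` as their `i`-th entry are
fixed and record the letter `i`, all others are conjugated by `s` and record nothing. -/
noncomputable def step (s : W) (hs : s * s = 1) : Equiv.Perm (Track ι W × FreeGroup ι) where
  toFun p := if h : ∃ i, p.1.1 i = s then (p.1, FreeGroup.of h.choose * p.2) else (p.1.conj s, p.2)
  invFun p :=
    if h : ∃ i, p.1.1 i = s then (p.1, (FreeGroup.of h.choose)⁻¹ * p.2) else (p.1.conj s, p.2)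
  left_inv p := by
    by_cases h : ∃ i, p.1.1 i = s
    · simp [h]
    · simp [h, conj_apply_eq_iff, conj_conj, hs]
  right_inv p := by
    by_cases h : ∃ i, p.1.1 i = s
    · simp [h]
    · simp [h, conj_apply_eq_iff, conj_conj, hs]

variable {s : W} (hs : s * s = 1)

theorem step_of_eq {p : Track ι W × FreeGroup ι} {i : ι} (h : p.1.1 i = s) :
    step s hs p = (p.1, FreeGroup.of i * p.2) := by
  have h' : ∃ i, p.1.1 i = s := ⟨i, h⟩
  have := eq_of_apply_eq hs h'.choose_spec h
  simp only [step, Equiv.coe_fn_mk, dif_pos h', this]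

theorem step_of_forall_ne {p : Track ι W × FreeGroup ι} (h : ∀ i, p.1.1 i ≠ s) :
    step s hs p = (p.1.conj s, p.2) := by
  have h' : ¬ ∃ i, p.1.1 i = s := fun ⟨i, hi⟩ => h i hi
  simp only [step, Equiv.coe_fn_mk, dif_neg h']

theorem signChanges_step_le [DecidableEq ι] (p : Track ι W × FreeGroup ι) :
    signChanges true (step s hs p).2.toWord ≤ signChanges true p.2.toWord := by
  by_cases h : ∃ i, p.1.1 i = s
  · obtain ⟨i, hi⟩ := h
    rw [step_of_eq hs hi]
    exact signChanges_toWord_mk_mul_le true i p.2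
  · rw [step_of_forall_ne hs fun i hi => h ⟨i, hi⟩]

theorem step_inv_of_eq {p : Track ι W × FreeGroup ι} {i : ι} (h : p.1.1 i = s) :
    (step s hs)⁻¹ p = (p.1, (FreeGroup.of i)⁻¹ * p.2) := by
  rw [Equiv.Perm.inv_eq_iff_eq, step_of_eq hs (p := (p.1, (FreeGroup.of i)⁻¹ * p.2)) h,
    mul_inv_cancel_left]

theorem step_inv_of_forall_ne {p : Track ι W × FreeGroup ι} (h : ∀ i, p.1.1 i ≠ s) :
    (step s hs)⁻¹ p = (p.1.conj s, p.2) := by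
  rw [Equiv.Perm.inv_eq_iff_eq, step_of_forall_ne hs fun i hi => h i ((conj_apply_eq_iff _ _).1 hi),
    conj_conj, hs, conj_one]

theorem signChanges_step_inv_le [DecidableEq ι] (p : Track ι W × FreeGroup ι) :
    signChanges false ((step s hs)⁻¹ p).2.toWord ≤ signChanges false p.2.toWord := by
  by_cases h : ∃ i, p.1.1 i = s
  · obtain ⟨i, hi⟩ := h
    rw [step_inv_of_eq hs hi]
    exact signChanges_toWord_mk_mul_le false i p.2
  · rw [step_inv_of_forall_ne hs fun i hi => h ⟨i, hi⟩]

variable {X : Type*} {f : X → W} (hf : ∀ x, f x * f x = 1)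

/-- An alternating word traced on a tuple of which only the `i`-th entry can be met by a letter. -/
theorem lift_altProd_inv_apply (i : ι) (k : ℕ) (x y : X) (p : Track ι W × FreeGroup ι)
    (hp : ∀ j ≠ i, ∀ n : ℤ, p.1.1 j ≠ (f x * f y) ^ n * f x) :
    (FreeGroup.lift (fun z => (step (f z) (hf z))⁻¹) (altProd k x y))⁻¹ p =
      (p.1.conj (p.1.1 i ^ hits (f x) (f y) (p.1.1 i) k * FreeGroup.lift f (altProd k x y)),
        FreeGroup.of i ^ hits (f x) (f y) (p.1.1 i) k * p.2) := by
  induction k generalizing x y p with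
  | zero => simp [altProd, hits]
  | succ k ih =>
    simp only [altProd, map_mul, FreeGroup.lift_apply_of, mul_inv_rev, inv_inv, Equiv.Perm.mul_apply]
    rw [hits_succ (hf x)]
    have hxx (g : W) : f x * (f x * g) = g := by rw [← mul_assoc, hf, one_mul]
    by_cases h : p.1.1 i = f x
    · rw [step_of_eq (hf x) h, ih]
      · have h' : f x * p.1.1 i * f x = p.1.1 i := by rw [h, hf, one_mul]
        rw [h', if_pos h.symm]
        refine Prod.ext ?_ ?_
        · simp only [pow_succ, h, mul_assoc, hxx]
        · simp only [pow_succ, mul_assoc]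
      · intro j hj n hn
        exact hp j hj (-n - 1) (hn.trans (mul_zpow_mul_swap (hf x) (hf y) n))
    · have hne (j : ι) : p.1.1 j ≠ f x := by
        by_cases hj : j = i
        · rwa [hj]
        · simpa using hp j hj 0
      rw [step_of_forall_ne (hf x) hne, ih]
      · simp only [conj_apply_of_mul_self (hf x), if_neg (Ne.symm h), add_zero, conj_conj]
        have hpow (n : ℕ) : (f x * p.1.1 i * f x) ^ n = f x * p.1.1 i ^ n * f x := by
          have := conj_pow (i := n) (a := f x) (b := p.1.1 i)
          rwa [inv_eq_of_mul_eq_one_left (hf x)] at this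
        rw [hpow]
        simp only [mul_assoc, hxx]
      · intro j hj n hn
        refine hp j hj (n + 1) ?_
        rw [conj_apply_of_mul_self (hf x)] at hn
        have h' : p.1.1 j = f x * ((f y * f x) ^ n * f y) * f x := by
          rw [← hn]
          simp only [mul_assoc, hxx, hf, mul_one]
        rw [h', mul_zpow_mul (f x) (f y), zpow_add_one]
        simp only [mul_assoc]

theorem lift_altProd_comm {x y : X} {k : ℕ} (hk0 : k ≠ 0) (hk : (f x * f y) ^ k = 1)
    (hW : FreeGroup.lift f (altProd k x y) = FreeGroup.lift f (altProd k y x))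
    [Nonempty ι] :
    FreeGroup.lift (fun z => (step (ι := ι) (f z) (hf z))⁻¹) (altProd k x y) =
      FreeGroup.lift (fun z => (step (f z) (hf z))⁻¹) (altProd k y x) := by
  have hinv (z : X) : (f z)⁻¹ = f z := inv_eq_of_mul_eq_one_left (hf z)
  have hyx : f y * f x = (f x * f y)⁻¹ := by rw [mul_inv_rev, hinv, hinv]
  rw [← inv_inj]
  ext1 p
  obtain ⟨i, hi⟩ : ∃ i, ∀ j ≠ i, ∀ n : ℤ, p.1.1 j ≠ (f x * f y) ^ n * f x := by
    by_cases h : ∃ i, ∃ n : ℤ, p.1.1 i = (f x * f y) ^ n * f x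
    · obtain ⟨i, n, hn⟩ := h
      refine ⟨i, fun j hj l hl => p.1.2 hj ?_⟩
      have : p.1.1 j * p.1.1 i = (f x * f y) ^ (l - n) := by
        rw [hn, hl, mul_zpow_mul (f x) (f y) n, mul_assoc, ← mul_assoc (f x), hf, one_mul, hyx,
          inv_zpow', ← zpow_add, sub_eq_add_neg]
      rw [this]
      exact (isOfFinOrder_iff_pow_eq_one.2 ⟨k, Nat.pos_of_ne_zero hk0, hk⟩).zpow
    · push Not at h
      exact ⟨Classical.arbitrary ι, fun j _ => h j⟩
  have hi' : ∀ j ≠ i, ∀ n : ℤ, p.1.1 j ≠ (f y * f x) ^ n * f y := by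
    intro j hj n hn
    exact hi j hj (-n - 1) (hn.trans (mul_zpow_mul_swap (hf x) (hf y) n))
  rw [lift_altProd_inv_apply hf i k x y p hi, lift_altProd_inv_apply hf i k y x p hi', hW,
    hits_comm (hf x) (hf y) hk]

end Track

end Track

/-! ### The action of the Artin group -/

section ArtinAction

variable {X W ι : Type*} [Group W] [Nonempty ι] {m : X → X → ℕ∞} {f : X → W}

theorem lift_eq_one_of_mem_artinRels {G : Type*} [Group G] (F : X → G)
    (h : ∀ (x y : X) (k : ℕ), x ≠ y → m x y = k →
      FreeGroup.lift F (altProd k x y) = FreeGroup.lift F (altProd k y x)) :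
    ∀ r ∈ artinRels m, FreeGroup.lift F r = 1 := by
  rintro r ⟨x, y, k, hxy, hk, rfl⟩
  rw [map_mul, map_inv, h x y k hxy hk, mul_inv_cancel]

theorem lift_altProd_mul_inv {G : Type*} [Group G] {f : X → G} (hf : ∀ x, f x * f x = 1)
    (x y : X) (k : ℕ) :
    FreeGroup.lift f (altProd k x y) * (FreeGroup.lift f (altProd k y x))⁻¹ = (f x * f y) ^ k := by
  induction k generalizing x y with
  | zero => simp [altProd]
  | succ k ih =>
    simp only [altProd, map_mul, FreeGroup.lift_apply_of, mul_inv_rev]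
    rw [inv_eq_of_mul_eq_one_left (hf y), mul_assoc, ← mul_assoc _ _ (f y), ih, ← mul_assoc,
      ← mul_pow_mul, pow_succ, mul_assoc]

/-- The homomorphism from the Artin group to permutations given by the steps of an assignment of
involutions to the generators. -/
noncomputable def artinAction (ι : Type*) [Nonempty ι] (hf : ∀ x, f x * f x = 1)
    (hm : ∀ (x y : X) (k : ℕ), x ≠ y → m x y = k → k ≠ 0 ∧ (f x * f y) ^ k = 1) :
    ArtinGroup m →* Equiv.Perm (Track ι W × FreeGroup ι) :=
  PresentedGroup.toGroup (f := fun z => (Track.step (f z) (hf z))⁻¹) <|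
    lift_eq_one_of_mem_artinRels _ fun x y k hxy hk =>
      Track.lift_altProd_comm hf (hm x y k hxy hk).1 (hm x y k hxy hk).2 <|
        mul_inv_eq_one.1 <| (lift_altProd_mul_inv hf x y k).trans (hm x y k hxy hk).2

variable (hf : ∀ x, f x * f x = 1)
  (hm : ∀ (x y : X) (k : ℕ), x ≠ y → m x y = k → k ≠ 0 ∧ (f x * f y) ^ k = 1)

theorem artinAction_artinGen (x : X) :
    artinAction ι hf hm (artinGen m x) = (Track.step (f x) (hf x))⁻¹ :=
  PresentedGroup.toGroup.of _

theorem artinAction_pow_apply {x y : X} {i j : ι} {r : Track ι W} (hi : r.1 i = f x)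
    (hj : r.1 j = f y) (n : ℕ) :
    artinAction ι hf hm ((artinGen m x * (artinGen m y)⁻¹) ^ n) (r, 1) =
      (r, ((FreeGroup.of i)⁻¹ * FreeGroup.of j) ^ n) := by
  induction n with
  | zero => simp
  | succ n ih =>
    rw [pow_succ', map_mul, Equiv.Perm.mul_apply, ih, map_mul, map_inv, artinAction_artinGen,
      artinAction_artinGen, inv_inv, Equiv.Perm.mul_apply, Track.step_of_eq (hf y) (p := (r, _)) hj,
      Track.step_inv_of_eq (hf x) (p := (r, _)) hi, pow_succ', mul_assoc]

variable [DecidableEq ι]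

theorem signChanges_artinAction_le {g : ArtinGroup m} (hg : g ∈ artinMonoid m) :
    ∀ p, signChanges false (artinAction ι hf hm g p).2.toWord ≤ signChanges false p.2.toWord := by
  induction hg using Submonoid.closure_induction with
  | mem g hg =>
    obtain ⟨x, rfl⟩ := hg
    rw [artinAction_artinGen]
    exact Track.signChanges_step_inv_le (hf x)
  | one => simp
  | mul g h _ _ ihg ihh =>
    intro p
    rw [map_mul]
    exact (ihg _).trans (ihh p)

theorem signChanges_artinAction_inv_le {g : ArtinGroup m} (hg : g ∈ artinMonoid m) :
    ∀ p, signChanges true (artinAction ι hf hm g⁻¹ p).2.toWord ≤ signChanges true p.2.toWord := by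
  induction hg using Submonoid.closure_induction with
  | mem g hg =>
    obtain ⟨x, rfl⟩ := hg
    rw [map_inv, artinAction_artinGen, inv_inv]
    exact Track.signChanges_step_le (hf x)
  | one => simp
  | mul g h _ _ ihg ihh =>
    intro p
    rw [mul_inv_rev, map_mul]
    exact (ihh _).trans (ihg p)

theorem signChanges_artinAction_prod_le (r : Track ι W) (l : List (ArtinGroup m))
    (hl : ∀ a ∈ l, a ∈ artinMonoid m ∨ a⁻¹ ∈ artinMonoid m) (ε : Bool) :
    signChanges ε (artinAction ι hf hm l.prod (r, 1)).2.toWord ≤ l.length := by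
  induction l generalizing ε with
  | nil => simp [signChanges]
  | cons a l ih =>
    rw [List.prod_cons, map_mul, Equiv.Perm.mul_apply, List.length_cons]
    set q := artinAction ι hf hm l.prod (r, 1)
    have ih' := ih fun b hb => hl b (List.mem_cons_of_mem a hb)
    rcases hl a List.mem_cons_self with ha | ha
    · exact (signChanges_le_add_one ε false _).trans <| Nat.add_le_add_right
        ((signChanges_artinAction_le hf hm ha q).trans (ih' false)) 1
    · have := signChanges_artinAction_inv_le (ι := ι) hf hm ha q
      rw [inv_inv] at this
      exact (signChanges_le_add_one ε true _).trans <| Nat.add_le_add_right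
        (this.trans (ih' true)) 1

end ArtinAction

theorem exists_list_prod_eq_pow {G : Type*} [Group G] {M : Submonoid G} {a b : G} (ha : a ∈ M)
    (hb : b ∈ M) (n : ℕ) :
    ∃ l : List G, (∀ c ∈ l, c ∈ M ∨ c⁻¹ ∈ M) ∧ (a * b⁻¹) ^ n = l.prod := by
  induction n with
  | zero => exact ⟨[], by simp, by simp⟩
  | succ n ih =>
    obtain ⟨l, hl, h⟩ := ih
    exact ⟨a :: b⁻¹ :: l, by simpa [ha, hb] using hl, by simp [pow_succ', h, mul_assoc]⟩

/-- If `Γ` has two vertices not connected by an edge (`m x y = ∞`), then the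
monoid Cayley graph of `A_Γ` has infinite diameter. -/
theorem artin_infinite_diameter_of_infinite_label {X : Type*} [Fintype X] (m : X → X → ℕ∞)
    (hsymm : ∀ x y : X, m x y = m y x) (hge2 : ∀ x y : X, x ≠ y → 2 ≤ m x y)
    (x y : X) (hxy : x ≠ y) (hinf : m x y = ⊤) :
    ∀ n : ℕ, ∃ g : ArtinGroup m, n < monoidDist (artinMonoid m) 1 g := by
  intro n
  obtain ⟨f, hf, hfin, htop⟩ := exists_involutions_of_labels m hsymm hge2
  have hm (x y : X) (k : ℕ) (hxy : x ≠ y) (hk : m x y = k) : k ≠ 0 ∧ (f x * f y) ^ k = 1 := by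
    refine ⟨?_, hfin x y k hxy hk⟩
    rintro rfl
    simpa [hk] using hge2 x y hxy
  let r : Track Bool _ := ⟨fun i => cond i (f x) (f y), by
    rintro (_ | _) (_ | _) hij
    · exact absurd rfl hij
    · exact htop y x hxy.symm (hsymm y x ▸ hinf)
    · exact htop x y hxy hinf
    · exact absurd rfl hij⟩
  refine ⟨(artinGen m x * (artinGen m y)⁻¹) ^ (n + 1), ?_⟩
  have hmem (z : X) : artinGen m z ∈ artinMonoid m := Submonoid.subset_closure ⟨z, rfl⟩
  obtain ⟨l, hl, hprod⟩ := exists_list_prod_eq_pow (hmem x) (hmem y) (n + 1)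
  refine Nat.succ_le_iff.1 <| le_csInf ⟨l.length, l, rfl, hl, by simpa using hprod⟩ ?_
  rintro _ ⟨l', rfl, hl', hprod'⟩
  have h := signChanges_artinAction_prod_le hf hm r l' hl' true
  rw [← hprod', inv_one, one_mul,
    artinAction_pow_apply hf hm (i := true) (j := false) rfl rfl] at h
  exact (le_signChanges_inv_mul_pow (by decide) (n + 1) true).trans h
end
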